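/- arXiv:0711.4597 — 9 statements merged into one kernel-verified Lean document; each statement's English description precedes it below -/
import Mathlib

section
/- Let q be an odd prime power and F_q the finite field with q elements. Let d ≥ 2, let E ⊆ F_q^d, fix 1 ≤ j ≤ d and z ∈ F_q such that z is the j-th coordinate of some point of E, and let C > 0. If |E| · |E^j_z| ≥ C q^d, then the pinned distance set satisfies |Δ^j_z(E)| ≥ (C/(C+3)) · q. -/
open Finset in
/-- Cauchy–Schwarz: the number of collisions of a map on `A` is bounded below in terms of the size
of its image. -/
lemma card_sq_le_card_image_mul_card_collisions {α β : Type*} [DecidableEq β]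
    (A : Finset α) (φ : α → β) :
    #A ^ 2 ≤ #(A.image φ) * #{x ∈ A ×ˢ A | φ x.1 = φ x.2} := by
  have hfiber : #{x ∈ A ×ˢ A | φ x.1 = φ x.2} = ∑ t ∈ A.image φ, #{a ∈ A | φ a = t} ^ 2 := by
    rw [card_eq_sum_card_fiberwise (f := fun x : α × α => φ x.1) (t := A.image φ)]
    · refine sum_congr rfl fun t _ => ?_
      rw [sq, ← card_product]
      congr 1
      ext x
      simp only [mem_filter, mem_product]
      grind
    · intro x hx
      simp only [coe_filter, mem_product, Set.mem_ofPred_eq] at hx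
      exact mem_coe.2 (mem_image_of_mem φ hx.1.1)
  rw [hfiber, card_eq_sum_card_image φ A]
  exact sq_sum_le_card_mul_sum_sq

open Finset in
/-- Expansion of the second moment of a sum of values of an additive character. -/
lemma AddChar.sum_norm_sq_sum {G α κ : Type*} [AddCommGroup G] [Finite G] (ψ : AddChar G ℂ)
    (K : Finset κ) (A : Finset α) (f : κ → α → G) :
    ((∑ k ∈ K, ‖∑ a ∈ A, ψ (f k a)‖ ^ 2 : ℝ) : ℂ) =
      ∑ x ∈ A ×ˢ A, ∑ k ∈ K, ψ (f k x.1 - f k x.2) := by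
  rw [sum_comm]
  push_cast
  refine sum_congr rfl fun k _ => ?_
  rw [← Complex.mul_conj', map_sum, sum_mul_sum, sum_product]
  simp only [sub_eq_add_neg, AddChar.map_add_eq_mul, AddChar.map_neg_eq_conj]

section AdditiveCharacter

variable {F : Type*} [Field F] [Fintype F] [DecidableEq F] {ψ : AddChar F ℂ}

open Finset in
lemma AddChar.IsPrimitive.sum_norm_sq_eq_card_collisions (hψ : ψ.IsPrimitive) {α : Type*}
    (A : Finset α) (φ : α → F) :
    ∑ s, ‖∑ a ∈ A, ψ (s * φ a)‖ ^ 2 =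
      Fintype.card F * (#{x ∈ A ×ˢ A | φ x.1 = φ x.2} : ℝ) := by
  rw [← Complex.ofReal_inj, AddChar.sum_norm_sq_sum]
  simp only [← mul_sub, AddChar.sum_mulShift _ hψ, sub_eq_zero]
  rw [card_filter]
  push_cast
  rw [mul_sum]
  refine sum_congr rfl fun x _ => ?_
  split_ifs <;> simp

open Finset in
lemma AddChar.IsPrimitive.sum_linearForm (hψ : ψ.IsPrimitive) {ι : Type*} [Fintype ι]
    [DecidableEq ι] (c : ι → F) :
    ∑ u : ι → F, ψ (∑ i, u i * c i) =
      if c = 0 then (Fintype.card F : ℂ) ^ Fintype.card ι else 0 := by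
  have hprod (u : ι → F) : ψ (∑ i, u i * c i) = ∏ i, ψ (u i * c i) :=
    map_prod ψ.toMonoidHom (fun i => Multiplicative.ofAdd (u i * c i)) univ
  simp only [hprod]
  rw [← Fintype.piFinset_univ, sum_prod_piFinset univ fun i a => ψ (a * c i)]
  simp only [AddChar.sum_mulShift _ hψ]
  split_ifs with hc
  · simp [hc]
  · obtain ⟨i, hi⟩ := Function.ne_iff.1 hc
    exact prod_eq_zero (mem_univ i) (by simpa using hi)

open Finset in
lemma AddChar.IsPrimitive.sum_norm_sq_quadratic (hψ : ψ.IsPrimitive) (h2 : (2 : F) ≠ 0)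
    {ι : Type*} [Fintype ι] [DecidableEq ι] (B : Finset (ι → F)) {s : F} (hs : s ≠ 0) :
    ∑ u : ι → F, ‖∑ y ∈ B, ψ (s * ∑ i, (u i - y i) ^ 2)‖ ^ 2 =
      (Fintype.card F : ℝ) ^ Fintype.card ι * #B := by
  rw [← Complex.ofReal_inj, AddChar.sum_norm_sq_sum]
  have hsplit (x : (ι → F) × (ι → F)) (u : ι → F) :
      s * ∑ i, (u i - x.1 i) ^ 2 - s * ∑ i, (u i - x.2 i) ^ 2 =
        s * ∑ i, (x.1 i ^ 2 - x.2 i ^ 2) + ∑ i, u i * ((2 * s) • (x.2 - x.1)) i := by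
    simp only [mul_sum, ← sum_sub_distrib, ← sum_add_distrib, Pi.smul_apply, Pi.sub_apply,
      smul_eq_mul]
    exact sum_congr rfl fun i _ => by ring
  simp only [hsplit, AddChar.map_add_eq_mul, ← mul_sum, hψ.sum_linearForm, smul_eq_zero,
    mul_eq_zero, h2, hs, false_or, sub_eq_zero]
  rw [sum_product]
  simp [mul_comm]

open Finset in
lemma AddChar.IsPrimitive.norm_sq_sum_quadratic_le (hψ : ψ.IsPrimitive) (h2 : (2 : F) ≠ 0)
    {ι α : Type*} [Fintype ι] [DecidableEq ι] (A : Finset α) (B : Finset (ι → F))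
    (w : α → F) (p : α → ι → F) {s : F} (hs : s ≠ 0) :
    ‖∑ x ∈ A ×ˢ B, ψ (s * (w x.1 + ∑ i, (p x.1 i - x.2 i) ^ 2))‖ ^ 2 ≤
      (∑ u : ι → F, ‖∑ a ∈ A with p a = u, ψ (s * w a)‖ ^ 2) *
        ((Fintype.card F : ℝ) ^ Fintype.card ι * #B) := by
  have hsum : ∑ x ∈ A ×ˢ B, ψ (s * (w x.1 + ∑ i, (p x.1 i - x.2 i) ^ 2)) =
      ∑ u : ι → F, (∑ a ∈ A with p a = u, ψ (s * w a)) *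
        ∑ y ∈ B, ψ (s * ∑ i, (u i - y i) ^ 2) := by
    rw [sum_product, ← sum_fiberwise A p]
    refine sum_congr rfl fun u _ => ?_
    rw [sum_mul]
    refine sum_congr rfl fun a ha => ?_
    rw [mul_sum]
    refine sum_congr rfl fun y _ => ?_
    rw [(mem_filter.1 ha).2, mul_add, AddChar.map_add_eq_mul]
  rw [hsum, ← hψ.sum_norm_sq_quadratic h2 B hs]
  refine le_trans ?_ (sum_mul_sq_le_sq_mul_sq _ _ _)
  gcongr
  exact (norm_sum_le _ _).trans_eq (sum_congr rfl fun _ _ => norm_mul _ _)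

open Finset in
/-- If `a ↦ (w a, p a)` is at most `k`-to-one on `A`, then the values of `w a + ‖p a - y‖`
on `A × B` are nearly equidistributed in the `L²` sense. -/
lemma card_mul_card_collisions_le (h2 : (2 : F) ≠ 0) {ι α : Type*} [Fintype ι] [DecidableEq ι]
    (A : Finset α) (B : Finset (ι → F)) (w : α → F) (p : α → ι → F) (k : ℕ)
    (hk : ∀ a ∈ A, #{b ∈ A | p a = p b ∧ w a = w b} ≤ k) (φ : α × (ι → F) → F)
    (hφ : ∀ x, φ x = w x.1 + ∑ i, (p x.1 i - x.2 i) ^ 2) :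
    (Fintype.card F : ℝ) * #{x ∈ (A ×ˢ B) ×ˢ (A ×ˢ B) | φ x.1 = φ x.2} ≤
      (#A * #B : ℝ) ^ 2 + k * (Fintype.card F : ℝ) ^ (Fintype.card ι + 1) * (#A * #B) := by
  have hψ := AddChar.FiniteField.primitiveChar_to_Complex_isPrimitive F
  set ψ := AddChar.FiniteField.primitiveChar_to_Complex F
  have hfiber : ∑ s, ∑ u : ι → F, ‖∑ a ∈ A with p a = u, ψ (s * w a)‖ ^ 2 ≤
      Fintype.card F * (k * #A : ℝ) := by
    rw [sum_comm]
    simp only [hψ.sum_norm_sq_eq_card_collisions, ← mul_sum]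
    gcongr
    have hcount : ∑ u : ι → F,
        #{x ∈ {a ∈ A | p a = u} ×ˢ {a ∈ A | p a = u} | w x.1 = w x.2} =
          ∑ a ∈ A, #{b ∈ A | p a = p b ∧ w a = w b} := by
      rw [← sum_fiberwise A p]
      refine sum_congr rfl fun u _ => ?_
      rw [card_filter, sum_product]
      refine sum_congr rfl fun a ha => ?_
      rw [← card_filter, filter_filter]
      congr 1
      ext b
      simp only [mem_filter] at ha ⊢
      grind
    rw [← Nat.cast_sum, hcount]
    have hle := sum_le_card_nsmul A _ k hk
    rw [smul_eq_mul, mul_comm] at hle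
    exact_mod_cast hle
  rw [← hψ.sum_norm_sq_eq_card_collisions (A ×ˢ B) φ, ← add_sum_erase _ _ (mem_univ (0 : F))]
  refine add_le_add (by simp) ?_
  simp only [hφ]
  calc
    _ ≤ ∑ s ∈ univ.erase (0 : F), (∑ u : ι → F, ‖∑ a ∈ A with p a = u, ψ (s * w a)‖ ^ 2) *
          ((Fintype.card F : ℝ) ^ Fintype.card ι * #B) :=
      sum_le_sum fun s hs => hψ.norm_sq_sum_quadratic_le h2 A B w p (ne_of_mem_erase hs)
    _ ≤ (∑ s, ∑ u : ι → F, ‖∑ a ∈ A with p a = u, ψ (s * w a)‖ ^ 2) *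
          ((Fintype.card F : ℝ) ^ Fintype.card ι * #B) := by
      rw [← sum_mul]
      gcongr
      exact erase_subset _ _
    _ ≤ (Fintype.card F * (k * #A : ℝ)) * ((Fintype.card F : ℝ) ^ Fintype.card ι * #B) := by
      gcongr
    _ = _ := by ring

end AdditiveCharacter

open Finset in
lemma card_filter_removeNth_eq_and_sq_eq_le {F : Type*} [Field F] [DecidableEq F] {n : ℕ}
    (E : Finset (Fin (n + 1) → F)) (j : Fin (n + 1)) (z : F) (a : Fin (n + 1) → F) :
    #{b ∈ E | j.removeNth a = j.removeNth b ∧ (a j - z) ^ 2 = (b j - z) ^ 2} ≤ 2 := by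
  refine (card_le_card (t := {a, j.insertNth (2 * z - a j) (j.removeNth a)}) ?_).trans card_le_two
  intro b hb
  obtain ⟨-, hp, hw⟩ := mem_filter.1 hb
  rw [mem_insert, mem_singleton]
  rcases sq_eq_sq_iff_eq_or_eq_neg.1 hw with h | h
  · left
    rw [← j.insertNth_self_removeNth b, ← j.insertNth_self_removeNth a, hp, sub_left_inj.1 h]
  · right
    rw [← j.insertNth_self_removeNth b, hp]
    congr 1
    linear_combination h

/-- Pinned distance set theorem: if `q` is an odd prime power, `E ⊆ F_q^d` (`d ≥ 2`),
`z` is the `j`-th coordinate of some point of `E`, and `|E| * |E^j_z| ≥ C q^d`,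
then `|Δ^j_z(E)| ≥ (C/(C+3)) q`. -/
theorem pinned_distance_set_card
    (q : ℕ) (Fq : Type*) [Field Fq] [Fintype Fq] [DecidableEq Fq]
    (hcard : Fintype.card Fq = q) (hodd : Odd q)
    (d : ℕ) (hd : 2 ≤ d)
    (E : Finset (Fin d → Fq)) (j : Fin d) (z : Fq)
    (hz : ∃ x ∈ E, x j = z)
    (C : ℝ) (hC : 0 < C)
    (hsize : (E.card : ℝ) *
        (({y : Fin d → Fq | y j = z ∧ ∃ x ∈ E, ∀ i, i ≠ j → y i = x i}).ncard : ℝ)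
        ≥ C * (q : ℝ) ^ d) :
    (({t : Fq | ∃ x ∈ E,
        ∃ y ∈ {y : Fin d → Fq | y j = z ∧ ∃ x' ∈ E, ∀ i, i ≠ j → y i = x' i},
        ∑ i, (x i - y i) ^ 2 = t}).ncard : ℝ)
      ≥ (C / (C + 3)) * q := by
  subst hcard
  have h2 : (2 : Fq) ≠ 0 := Ring.two_ne_zero fun h =>
    Nat.not_even_iff_odd.2 hodd (Nat.even_iff.2 (FiniteField.even_card_of_char_two h))
  obtain ⟨n, rfl⟩ : ∃ n, d = n + 1 := ⟨d - 1, by omega⟩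
  set B : Finset (Fin n → Fq) := E.image j.removeNth
  have hpin : {y : Fin (n + 1) → Fq | y j = z ∧ ∃ x ∈ E, ∀ i, i ≠ j → y i = x i} =
      (j.insertNth z) '' (B : Set (Fin n → Fq)) := by
    ext y
    simp only [Set.mem_ofPred_eq, B, Finset.coe_image, Set.mem_image, Finset.mem_coe,
      exists_exists_and_eq_and]
    constructor
    · rintro ⟨rfl, x, hx, h⟩
      refine ⟨x, hx, ?_⟩
      rw [← j.insertNth_self_removeNth y]
      congr 1
      · simp
      · ext i
        simp [Fin.removeNth, h _ (j.succAbove_ne i)]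
    · rintro ⟨x, hx, rfl⟩
      refine ⟨by simp, x, hx, fun i hi => ?_⟩
      obtain ⟨i, rfl⟩ := Fin.exists_succAbove_eq hi
      simp [Fin.removeNth]
  let φ : (Fin (n + 1) → Fq) × (Fin n → Fq) → Fq := fun x =>
    (x.1 j - z) ^ 2 + ∑ i, (j.removeNth x.1 i - x.2 i) ^ 2
  have hdist : {t : Fq | ∃ x ∈ E,
      ∃ y ∈ {y : Fin (n + 1) → Fq | y j = z ∧ ∃ x' ∈ E, ∀ i, i ≠ j → y i = x' i},
        ∑ i, (x i - y i) ^ 2 = t} = ((E ×ˢ B).image φ : Finset Fq) := by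
    rw [hpin]
    ext t
    simp only [Set.mem_ofPred_eq, Fin.sum_univ_succAbove _ j, φ,
      Finset.coe_image, Set.mem_image, Finset.mem_coe, Finset.mem_product, Prod.exists,
      Fin.removeNth]
    constructor
    · rintro ⟨x, hx, _, ⟨y, hy, rfl⟩, h⟩
      exact ⟨x, y, ⟨hx, hy⟩, by simpa using h⟩
    · rintro ⟨x, y, ⟨hx, hy⟩, h⟩
      exact ⟨x, hx, _, ⟨y, hy, rfl⟩, by simpa using h⟩
  have hinj : Function.Injective (j.insertNth (α := fun _ => Fq) z) :=
    Fin.insertNth_right_injective (α := fun _ => Fq) z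
  rw [hpin, Set.ncard_image_of_injective _ hinj,
    Set.ncard_coe_finset] at hsize
  rw [hdist, Set.ncard_coe_finset]
  have hcoll := card_mul_card_collisions_le h2 E B (fun x => (x j - z) ^ 2) j.removeNth 2
    (fun a _ => card_filter_removeNth_eq_and_sq_eq_le E j z a) φ fun _ => rfl
  have hCS := card_sq_le_card_image_mul_card_collisions (E ×ˢ B) φ
  rw [← Nat.cast_le (α := ℝ), Finset.card_product] at hCS
  push_cast at hCS
  rw [Fintype.card_fin] at hcoll
  set N : ℝ := (E.card : ℝ) * B.card
  set q : ℝ := (Fintype.card Fq : ℝ)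
  set D : ℝ := (((E ×ˢ B).image φ).card : ℝ)
  have hq : 0 < q := Nat.cast_pos.2 Fintype.card_pos
  have hD : 0 ≤ D := Nat.cast_nonneg _
  have hN : 0 < N := lt_of_lt_of_le (by positivity) hsize
  have hmain : q * N ≤ D * (N + 2 * q ^ (n + 1)) := by
    refine le_of_mul_le_mul_right ?_ hN
    calc q * N * N = q * N ^ 2 := by ring
      _ ≤ q * (D * _) := mul_le_mul_of_nonneg_left hCS hq.le
      _ = D * (q * _) := by ring
      _ ≤ D * _ := mul_le_mul_of_nonneg_left hcoll hD
      _ = _ := by push_cast; ring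
  have hC' : C * q ≤ D * (C + 2) := by
    refine le_of_mul_le_mul_right ?_ hN
    nlinarith [mul_le_mul_of_nonneg_left hmain hC.le, mul_le_mul_of_nonneg_left hsize hD]
  rw [ge_iff_le, div_mul_eq_mul_div, div_le_iff₀ (by linarith)]
  linarith
end

section
/- Let q be an odd prime power, d ≥ 2, and C > 0. Suppose E = E_1 × E_2 × ⋯ × E_d ⊆ F_q^d is a Cartesian product of sets E_i ⊆ F_q, and |E| ≥ C q^{d^2/(2d-1)}. Then the distance set satisfies |Δ(E)| ≥ (C'/(C'+3)) · q, where C' = C^{(2d-1)/d}. -/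
open Finset in
/-- If `φ x y` takes values in `D` for `x ∈ E` and `y ∈ S`, and the family `φ x`, `x ∈ E`, has
few collisions on average over all `y`, then `D` is large. -/
theorem card_sq_mul_card_le_of_collisions {X Y F : Type*} [Fintype Y] [Fintype F]
    [DecidableEq F] (φ : X → Y → F) (E : Finset X) (S : Finset Y) (D : Finset F)
    (hD : ∀ x ∈ E, ∀ y ∈ S, φ x y ∈ D) (hS : S.Nonempty) (hF : 0 < Fintype.card F) (M : ℝ)
    (hM : ∑ x ∈ E, ∑ z ∈ E, (#{y : Y | φ x y = φ z y} : ℝ)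
      ≤ (#E : ℝ) ^ 2 * Fintype.card Y / Fintype.card F + M) :
    (#E : ℝ) ^ 2 * #S ≤ #D * ((#E : ℝ) ^ 2 * #S / Fintype.card F + M) := by
  classical
  set q : ℝ := (Fintype.card F : ℝ) with hq
  have hq0 : 0 < q := by rw [hq]; exact_mod_cast hF
  set e : ℝ := (#E : ℝ) with he
  let N : Y → F → ℝ := fun y t => ∑ x ∈ E, if φ x y = t then 1 else 0
  have hN1 : ∀ y, ∑ t, N y t = e := by
    intro y
    simp only [N]
    rw [sum_comm]
    simp [he]
  have hN1D : ∀ y ∈ S, ∑ t ∈ D, N y t = e := by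
    intro y hy
    simp only [N]
    rw [sum_comm, he, card_eq_sum_ones, Nat.cast_sum]
    refine sum_congr rfl fun x hx => ?_
    simp [hD x hx y hy]
  have hN2 : ∑ y, ∑ t, N y t ^ 2 = ∑ x ∈ E, ∑ z ∈ E, (#{y : Y | φ x y = φ z y} : ℝ) := by
    have h : ∀ y, ∑ t, N y t ^ 2 = ∑ x ∈ E, ∑ z ∈ E, if φ x y = φ z y then (1 : ℝ) else 0 := by
      intro y
      simp only [N, sq, sum_mul_sum]
      rw [sum_comm]
      refine sum_congr rfl fun x _ => ?_
      rw [sum_comm]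
      refine sum_congr rfl fun z _ => ?_
      simp [eq_comm]
    simp_rw [h]
    rw [sum_comm]
    refine sum_congr rfl fun x _ => ?_
    rw [sum_comm]
    refine sum_congr rfl fun z _ => ?_
    simp
  have hvar : ∀ y, ∑ t, (N y t - e / q) ^ 2 = ∑ t, N y t ^ 2 - e ^ 2 / q := by
    intro y
    have : ∀ t, (N y t - e / q) ^ 2 = N y t ^ 2 - 2 * (e / q) * N y t + (e / q) ^ 2 := by
      intro t; ring
    simp_rw [this]
    rw [sum_add_distrib, sum_sub_distrib, ← mul_sum, hN1, sum_const, card_univ, nsmul_eq_mul,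
      ← hq]
    field_simp
    ring
  have hle : ∑ y ∈ S, ∑ t, (N y t - e / q) ^ 2 ≤ ∑ y, ∑ t, (N y t - e / q) ^ 2 :=
    sum_le_sum_of_subset_of_nonneg (subset_univ S)
      fun y _ _ => sum_nonneg fun t _ => sq_nonneg _
  simp_rw [hvar] at hle
  rw [sum_sub_distrib, sum_sub_distrib, sum_const, sum_const, nsmul_eq_mul, nsmul_eq_mul, hN2,
    card_univ] at hle
  have hsec : ∑ y ∈ S, ∑ t, N y t ^ 2 ≤ e ^ 2 * #S / q + M := by
    have h1 : (Fintype.card Y : ℝ) * (e ^ 2 / q) = e ^ 2 * Fintype.card Y / q := by ring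
    have h2 : (#S : ℝ) * (e ^ 2 / q) = e ^ 2 * #S / q := by ring
    linarith
  have hcs : (∑ p ∈ S ×ˢ D, N p.1 p.2) ^ 2 ≤ #(S ×ˢ D) * ∑ p ∈ S ×ˢ D, N p.1 p.2 ^ 2 :=
    sq_sum_le_card_mul_sum_sq
  rw [sum_product, sum_product, sum_congr rfl hN1D, sum_const, nsmul_eq_mul, card_product,
    Nat.cast_mul] at hcs
  have hDle : ∑ y ∈ S, ∑ t ∈ D, N y t ^ 2 ≤ ∑ y ∈ S, ∑ t, N y t ^ 2 :=
    sum_le_sum fun y _ => sum_le_sum_of_subset_of_nonneg (subset_univ D)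
      fun t _ _ => sq_nonneg _
  have hs0 : (0 : ℝ) < #S := by exact_mod_cast hS.card_pos
  have hfin := hcs.trans (mul_le_mul_of_nonneg_left (hDle.trans hsec) (by positivity))
  refine le_of_mul_le_mul_left ?_ hs0
  nlinarith [hfin]

open Finset in
/-- The collision bound for the maps `y ↦ ‖x - y‖`, where the coordinate `y i₀` is frozen at `b`. -/
theorem sum_card_distance_collisions_le {ι F : Type*} [Fintype ι] [DecidableEq ι] [Field F]
    [Fintype F] [DecidableEq F] (h2 : (2 : F) ≠ 0) (i₀ : ι) (b : F) (E : Finset (ι → F)) :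
    ∑ x ∈ E, ∑ z ∈ E, (#{y : ι → F | ∑ i, (x i - Function.update y i₀ b i) ^ 2
        = ∑ i, (z i - Function.update y i₀ b i) ^ 2} : ℝ)
      ≤ (#E : ℝ) ^ 2 * Fintype.card (ι → F) / Fintype.card F
        + 2 * #E * Fintype.card (ι → F) := by
  set Q : ℝ := (Fintype.card (ι → F) : ℝ) with hQ
  set q : ℝ := (Fintype.card F : ℝ) with hq
  have hq0 : 0 < q := by rw [hq]; exact_mod_cast Fintype.card_pos
  have hQ0 : 0 ≤ Q := by positivity
  have key : ∀ x z : ι → F, (#{y : ι → F | ∑ i, (x i - Function.update y i₀ b i) ^ 2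
        = ∑ i, (z i - Function.update y i₀ b i) ^ 2} : ℝ)
      ≤ Q / q + if z ∈ ({x, Function.update x i₀ (2 * b - x i₀)} : Finset (ι → F))
        then Q else 0 := by
    intro x z
    by_cases hxz : ∃ j, j ≠ i₀ ∧ x j ≠ z j
    · obtain ⟨j, hj, hne⟩ := hxz
      have hcard : #{y : ι → F | ∑ i, (x i - Function.update y i₀ b i) ^ 2
          = ∑ i, (z i - Function.update y i₀ b i) ^ 2} ≤ Fintype.card ({i // i ≠ j} → F) := by
        rw [← card_univ]
        refine card_le_card_of_injOn (fun y i => y i.1) (fun _ _ => mem_coe.2 (mem_univ _)) ?_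
        intro y hy w hw hyw
        have hagree : ∀ i, i ≠ j → y i = w i := fun i hi => congrFun hyw ⟨i, hi⟩
        have hy' : ∑ i, (x i - Function.update y i₀ b i) ^ 2
          = ∑ i, (z i - Function.update y i₀ b i) ^ 2 := by simpa using hy
        have hw' : ∑ i, (x i - Function.update w i₀ b i) ^ 2
          = ∑ i, (z i - Function.update w i₀ b i) ^ 2 := by simpa using hw
        have hsum : ∑ i, ((x i - Function.update y i₀ b i) ^ 2
            - (z i - Function.update y i₀ b i) ^ 2 - ((x i - Function.update w i₀ b i) ^ 2
            - (z i - Function.update w i₀ b i) ^ 2)) = 0 := by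
          simp only [sum_sub_distrib, hy', hw', sub_self]
        rw [sum_eq_single j] at hsum
        · rw [Function.update_of_ne hj, Function.update_of_ne hj] at hsum
          have hprod : 2 * ((x j - z j) * (y j - w j)) = 0 := by linear_combination -hsum
          have hyj : y j - w j = 0 := by
            simpa [h2, sub_ne_zero.2 hne] using hprod
          funext i
          by_cases hi : i = j
          · rw [hi]; exact sub_eq_zero.1 hyj
          · exact hagree i hi
        · intro i _ hi
          by_cases hi0 : i = i₀
          · subst hi0; simp
          · rw [Function.update_of_ne hi0, Function.update_of_ne hi0, hagree i hi, sub_self]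
        · simp
      have hQq : Q / q = (Fintype.card ({i // i ≠ j} → F) : ℝ) := by
        have h := Fintype.card_congr (Equiv.funSplitAt j F)
        rw [Fintype.card_prod] at h
        rw [div_eq_iff hq0.ne', hQ, hq, h]
        push_cast
        ring
      have : (0 : ℝ) ≤ if z ∈ ({x, Function.update x i₀ (2 * b - x i₀)} : Finset (ι → F))
        then Q else 0 := by split_ifs <;> simp [hQ0]
      rw [hQq]
      have : (#{y : ι → F | ∑ i, (x i - Function.update y i₀ b i) ^ 2
          = ∑ i, (z i - Function.update y i₀ b i) ^ 2} : ℝ)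
          ≤ Fintype.card ({i // i ≠ j} → F) := by exact_mod_cast hcard
      linarith
    · push Not at hxz
      have hqq : 0 ≤ Q / q := by positivity
      split_ifs with hz
      · have : (#{y : ι → F | ∑ i, (x i - Function.update y i₀ b i) ^ 2
          = ∑ i, (z i - Function.update y i₀ b i) ^ 2} : ℝ) ≤ Q := by
          rw [hQ]; exact_mod_cast card_le_univ _
        linarith
      · have hempty : #{y : ι → F | ∑ i, (x i - Function.update y i₀ b i) ^ 2
          = ∑ i, (z i - Function.update y i₀ b i) ^ 2} = 0 := by
          rw [card_eq_zero, filter_eq_empty_iff]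
          intro y _ hy
          apply hz
          have hsum : ∑ i, ((x i - Function.update y i₀ b i) ^ 2
            - (z i - Function.update y i₀ b i) ^ 2) = 0 := by
            rw [sum_sub_distrib, hy, sub_self]
          rw [sum_eq_single i₀ (fun i _ hi => by rw [hxz i hi, sub_self]) (by simp),
            Function.update_self] at hsum
          have hprod : (z i₀ - x i₀) * (z i₀ - (2 * b - x i₀)) = 0 := by
            linear_combination -hsum
          rw [mem_insert, mem_singleton]
          rcases mul_eq_zero.1 hprod with h | h
          · left
            funext i
            by_cases hi : i = i₀
            · rw [hi]; exact sub_eq_zero.1 h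
            · exact (hxz i hi).symm
          · right
            funext i
            by_cases hi : i = i₀
            · rw [hi, Function.update_self]; exact sub_eq_zero.1 h
            · rw [Function.update_of_ne hi]; exact (hxz i hi).symm
        rw [hempty]
        simpa using hqq
  have hrow : ∀ x ∈ E, ∑ z ∈ E, (#{y : ι → F | ∑ i, (x i - Function.update y i₀ b i) ^ 2
        = ∑ i, (z i - Function.update y i₀ b i) ^ 2} : ℝ) ≤ #E * (Q / q) + 2 * Q := by
    intro x _
    refine (sum_le_sum fun z _ => key x z).trans ?_
    rw [sum_add_distrib, sum_const, nsmul_eq_mul, ← sum_filter, sum_const, nsmul_eq_mul]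
    gcongr
    have : #{z ∈ E | z ∈ ({x, Function.update x i₀ (2 * b - x i₀)} : Finset (ι → F))} ≤ 2 :=
      (card_le_card fun z hz => (mem_filter.1 hz).2).trans card_le_two
    exact_mod_cast this
  refine (sum_le_sum hrow).trans (le_of_eq ?_)
  rw [sum_const, nsmul_eq_mul]
  ring

open Finset in
/-- The distance set of a product set, in terms of the size of one of its factors. -/
theorem card_mul_sq_le_card_distances {ι F : Type*} [Fintype ι] [DecidableEq ι] [Field F]
    [Fintype F] [DecidableEq F] (h2 : (2 : F) ≠ 0) (B : ι → Finset F) (hB : ∀ i, (B i).Nonempty)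
    (D : Finset F)
    (hD : ∀ x ∈ Fintype.piFinset B, ∀ y ∈ Fintype.piFinset B, ∑ i, (x i - y i) ^ 2 ∈ D) (i₀ : ι) :
    (Fintype.card F : ℝ) * ((#(Fintype.piFinset B) : ℝ) ^ 2 / #(B i₀))
      ≤ #D * ((#(Fintype.piFinset B) : ℝ) ^ 2 / #(B i₀)
        + 2 * (Fintype.card F : ℝ) ^ Fintype.card ι) := by
  obtain ⟨b, hb⟩ := hB i₀
  set E := Fintype.piFinset B with hE
  set S := Fintype.piFinset (Function.update B i₀ univ) with hS
  have hSne : S.Nonempty := by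
    rw [hS, Fintype.piFinset_nonempty]
    intro i
    by_cases hi : i = i₀
    · subst hi; simp
    · rw [Function.update_of_ne hi]; exact hB i
  have hEpos : (0 : ℝ) < #E := by
    exact_mod_cast (Fintype.piFinset_nonempty.2 hB).card_pos
  have hBpos : (0 : ℝ) < #(B i₀) := by exact_mod_cast (hB i₀).card_pos
  have hqpos : (0 : ℝ) < Fintype.card F := by exact_mod_cast Fintype.card_pos
  have hmem : ∀ x ∈ E, ∀ y ∈ S, ∑ i, (x i - Function.update y i₀ b i) ^ 2 ∈ D := by
    intro x hx y hy
    refine hD x hx _ (Fintype.mem_piFinset.2 fun i => ?_)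
    by_cases hi : i = i₀
    · subst hi; simpa using hb
    · have := Fintype.mem_piFinset.1 hy i
      rwa [Function.update_of_ne hi] at this ⊢
  have hcardS : (#S : ℝ) * #(B i₀) = Fintype.card F * #E := by
    have h : #S * #(B i₀) = Fintype.card F * #E := by
      rw [hS, hE, Fintype.card_piFinset, Fintype.card_piFinset,
        Fintype.prod_eq_mul_prod_compl i₀, Fintype.prod_eq_mul_prod_compl i₀ (fun i => #(B i)),
        Function.update_self, card_univ,
        prod_congr rfl fun i hi => by
          rw [Function.update_of_ne (by simpa using hi)]]
      ring
    exact_mod_cast h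
  have hmain : (#E : ℝ) ^ 2 * #S ≤ #D * ((#E : ℝ) ^ 2 * #S / (Fintype.card F : ℝ)
      + 2 * (#E : ℝ) * (Fintype.card (ι → F) : ℝ)) := by
    refine card_sq_mul_card_le_of_collisions
      (fun x y => ∑ i, (x i - Function.update y i₀ b i) ^ 2) E S D hmem hSne Fintype.card_pos
      (2 * (#E : ℝ) * (Fintype.card (ι → F) : ℝ)) ?_
    exact sum_card_distance_collisions_le h2 i₀ b E
  rw [← eq_div_iff hBpos.ne'] at hcardS
  rw [hcardS, Fintype.card_fun, Nat.cast_pow] at hmain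
  generalize (#E : ℝ) = e at *
  generalize (#(B i₀) : ℝ) = a at *
  generalize (Fintype.card F : ℝ) = q at *
  refine le_of_mul_le_mul_left ?_ hEpos
  have hlhs : e ^ 2 * (q * e / a) = e * (q * (e ^ 2 / a)) := by ring
  have hrhs : (#D : ℝ) * (e ^ 2 * (q * e / a) / q + 2 * e * q ^ Fintype.card ι)
      = e * (#D * (e ^ 2 / a + 2 * q ^ Fintype.card ι)) := by
    field_simp
  rwa [hrhs, hlhs] at hmain

/-- Distance sets of Cartesian products: if `q` is an odd prime power, `d ≥ 2`,
`E = E_1 × ⋯ × E_d ⊆ F_q^d` and `|E| ≥ C q^{d²/(2d-1)}`, then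
`|Δ(E)| ≥ (C'/(C'+3)) q` where `C' = C^{(2d-1)/d}`. -/
theorem distance_set_of_product_card
    (q : ℕ) (Fq : Type*) [Field Fq] [Fintype Fq]
    (hcard : Fintype.card Fq = q) (hodd : Odd q)
    (d : ℕ) (hd : 2 ≤ d)
    (A : Fin d → Set Fq) (E : Set (Fin d → Fq))
    (hE : E = {x | ∀ i, x i ∈ A i})
    (C : ℝ) (hC : 0 < C)
    (hsize : (E.ncard : ℝ) ≥ C * (q : ℝ) ^ (((d : ℝ) ^ 2) / (2 * (d : ℝ) - 1))) :
    (({t : Fq | ∃ x ∈ E, ∃ y ∈ E, ∑ i, (x i - y i) ^ 2 = t}).ncard : ℝ)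
      ≥ (C ^ ((2 * (d : ℝ) - 1) / (d : ℝ)) / (C ^ ((2 * (d : ℝ) - 1) / (d : ℝ)) + 3)) * q := by
  classical
  have hd2 : (2 : ℝ) ≤ d := by exact_mod_cast hd
  have hq0 : (0 : ℝ) < q := by rw [← hcard]; exact_mod_cast Fintype.card_pos
  have h2 : (2 : Fq) ≠ 0 := by
    refine Ring.two_ne_zero fun hchar => ?_
    have := FiniteField.even_card_of_char_two hchar
    rw [hcard] at this
    exact absurd hodd (by rw [Nat.odd_iff]; omega)
  let B : Fin d → Finset Fq := fun i => (A i).toFinset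
  have hEB : E = (Fintype.piFinset B : Set (Fin d → Fq)) := by
    ext x; simp [hE, B]
  rw [hEB, Set.ncard_coe_finset] at hsize
  have hEpos : (0 : ℝ) < (Fintype.piFinset B).card := lt_of_lt_of_le (by positivity) hsize
  have hB : ∀ i, (B i).Nonempty :=
    Fintype.piFinset_nonempty.1 (Finset.card_pos.1 (by exact_mod_cast hEpos))
  obtain ⟨i₀, -, hmin⟩ := Finset.exists_min_image Finset.univ (fun i => (B i).card)
    ⟨(⟨0, by omega⟩ : Fin d), Finset.mem_univ _⟩
  have hpow : ((B i₀).card : ℝ) ^ d ≤ (Fintype.piFinset B).card := by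
    rw [Fintype.card_piFinset]
    have := Finset.prod_le_prod' (s := Finset.univ) (f := fun _ : Fin d => (B i₀).card)
      (g := fun i => (B i).card) hmin
    rw [Finset.prod_const, Finset.card_univ, Fintype.card_fin] at this
    exact_mod_cast this
  set Δ := {t : Fq | ∃ x ∈ E, ∃ y ∈ E, ∑ i, (x i - y i) ^ 2 = t} with hΔ
  have hmain := card_mul_sq_le_card_distances h2 B hB Δ.toFinset (fun x hx y hy => by
    rw [Set.mem_toFinset, hΔ]
    exact ⟨x, by rw [hEB]; exact hx, y, by rw [hEB]; exact hy, rfl⟩) i₀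
  rw [hcard, Fintype.card_fin, ← Set.ncard_eq_toFinset_card' Δ] at hmain
  have hBpos : (0 : ℝ) < (B i₀).card := by exact_mod_cast (hB i₀).card_pos
  set e : ℝ := ((Fintype.piFinset B).card : ℝ)
  set a : ℝ := ((B i₀).card : ℝ)
  set K := C ^ ((2 * (d : ℝ) - 1) / (d : ℝ)) with hK
  have hK0 : 0 < K := Real.rpow_pos_of_pos hC _
  have ha : a ≤ e ^ ((1 : ℝ) / d) := by
    rw [one_div, Real.le_rpow_inv_iff_of_pos hBpos.le hEpos.le (by linarith), Real.rpow_natCast]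
    exact hpow
  have hL : K * (q : ℝ) ^ d ≤ e ^ 2 / a := by
    calc K * (q : ℝ) ^ d
        = (C * (q : ℝ) ^ (((d : ℝ) ^ 2) / (2 * (d : ℝ) - 1))) ^ ((2 * (d : ℝ) - 1) / (d : ℝ)) := by
          rw [Real.mul_rpow hC.le (by positivity), ← Real.rpow_mul hq0.le, ← Real.rpow_natCast]
          congr 2
          have : 2 * (d : ℝ) - 1 ≠ 0 := by linarith
          rw [div_mul_div_comm, mul_comm (2 * (d : ℝ) - 1), mul_div_mul_right _ _ this]
          field_simp
      _ ≤ e ^ ((2 * (d : ℝ) - 1) / (d : ℝ)) :=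
          Real.rpow_le_rpow (by positivity) hsize (div_nonneg (by linarith) (by linarith))
      _ = e ^ 2 / e ^ ((1 : ℝ) / d) := by
          rw [← Real.rpow_natCast e 2, ← Real.rpow_sub hEpos]
          congr 1
          push_cast
          field_simp
      _ ≤ e ^ 2 / a := by gcongr
  have hQ : (0 : ℝ) < (q : ℝ) ^ d := by positivity
  set L := e ^ 2 / a
  set Q := (q : ℝ) ^ d
  have hL0 : 0 < L := lt_of_lt_of_le (by positivity) hL
  rw [ge_iff_le]
  calc K / (K + 3) * q ≤ L / (L + 2 * Q) * q := by
        gcongr ?_ * _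
        rw [div_le_div_iff₀ (by positivity) (by positivity)]
        nlinarith
    _ ≤ Δ.ncard := by
        rw [div_mul_eq_mul_div, div_le_iff₀ (by positivity)]
        linarith
end

section
/- Let q be a prime power and A ⊆ F_q. If |A| > q^{3/4}, then every nonzero element of F_q belongs to A·A + A·A; that is, F_q \ {0} ⊆ {ab + cd : a, b, c, d ∈ A}. -/
/-- A line in the affine plane over a finite field has as many points as the field. -/
lemma card_line {F : Type*} [Field F] [Fintype F] [DecidableEq F]
    {t : F} {y : F × F} (hy : y ≠ 0) :
    (Finset.univ.filter fun x : F × F => x.1 * y.1 + x.2 * y.2 = t).card = Fintype.card F := by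
  rw [← Finset.card_univ]
  symm
  by_cases h : y.1 = 0
  · have h2 : y.2 ≠ 0 := fun h2 => hy (Prod.ext h h2)
    refine Finset.card_bij (fun s _ => (s, t / y.2)) ?_ ?_ ?_
    · intro s _
      simp [h, h2]
    · intro s _ s' _ hs
      exact congrArg Prod.fst hs
    · rintro ⟨u, v⟩ hu
      refine ⟨u, Finset.mem_univ _, ?_⟩
      simp only [Finset.mem_filter, Finset.mem_univ, true_and, h, mul_zero, zero_add] at hu
      simp [← hu, h2]
  · refine Finset.card_bij (fun s _ => ((t - s * y.2) / y.1, s)) ?_ ?_ ?_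
    · intro s _
      simp [h]
    · intro s _ s' _ hs
      exact congrArg Prod.snd hs
    · rintro ⟨u, v⟩ hu
      refine ⟨v, Finset.mem_univ _, ?_⟩
      simp only [Finset.mem_filter, Finset.mem_univ, true_and] at hu
      simp [← hu, h]

/-- Two distinct lines `x ⬝ y = t` and `x ⬝ z = t` with `t ≠ 0` meet in at most one point. -/
lemma card_line_inter_le_one {F : Type*} [Field F] [Fintype F] [DecidableEq F]
    {t : F} (ht : t ≠ 0) {y z : F × F} (hyz : y ≠ z) :
    (Finset.univ.filter fun x : F × F =>
      x.1 * y.1 + x.2 * y.2 = t ∧ x.1 * z.1 + x.2 * z.2 = t).card ≤ 1 := by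
  rw [Finset.card_le_one]
  intro u hu v hv
  simp only [Finset.mem_filter, Finset.mem_univ, true_and] at hu hv
  obtain ⟨hu1, hu2⟩ := hu
  obtain ⟨hv1, hv2⟩ := hv
  have hdet : y.1 * z.2 - y.2 * z.1 ≠ 0 := by
    intro h
    apply hyz
    refine Prod.ext (mul_left_cancel₀ ht ?_) (mul_left_cancel₀ ht ?_)
    · linear_combination (-y.1) * hu2 + z.1 * hu1 + u.2 * h
    · linear_combination (-y.2) * hu2 + z.2 * hu1 - u.1 * h
  refine Prod.ext (mul_left_cancel₀ hdet ?_) (mul_left_cancel₀ hdet ?_)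
  · linear_combination z.2 * (hu1 - hv1) - y.2 * (hu2 - hv2)
  · linear_combination y.1 * (hu2 - hv2) - z.1 * (hu1 - hv1)

/-- Variance bound for the number of points of `S` on the line `x ⬝ y = t`, where `x` ranges over
the plane. -/
lemma sum_sq_card_line_le {F : Type*} [Field F] [Fintype F] [DecidableEq F]
    {t : F} (ht : t ≠ 0) {S : Finset (F × F)} (hS : ∀ y ∈ S, y ≠ 0) :
    ∑ x : F × F, ((Fintype.card F : ℤ) *
        ((S.filter fun y => x.1 * y.1 + x.2 * y.2 = t).card : ℤ) - S.card) ^ 2 ≤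
      (Fintype.card F : ℤ) ^ 2 * ((Fintype.card F - 1) * S.card) := by
  set q : ℤ := (Fintype.card F : ℤ) with hq
  set f : F × F → ℤ := fun x => ((S.filter fun y => x.1 * y.1 + x.2 * y.2 = t).card : ℤ) with hf
  have hfsum (x : F × F) : f x = ∑ y ∈ S, if x.1 * y.1 + x.2 * y.2 = t then (1 : ℤ) else 0 := by
    simp [hf]
  have first_moment : ∑ x, f x = q * S.card := by
    simp_rw [hfsum]
    rw [Finset.sum_comm]
    have : ∀ y ∈ S, (∑ x : F × F, if x.1 * y.1 + x.2 * y.2 = t then (1 : ℤ) else 0) = q := by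
      intro y hy
      rw [Finset.sum_boole, card_line (hS y hy)]
    rw [Finset.sum_congr rfl this]
    simp [mul_comm]
  have second_moment : ∑ x, f x ^ 2 ≤ S.card * (S.card + q - 1) := by
    have hsq (x : F × F) : f x ^ 2 = ∑ y ∈ S, ∑ z ∈ S,
        if x.1 * y.1 + x.2 * y.2 = t ∧ x.1 * z.1 + x.2 * z.2 = t then (1 : ℤ) else 0 := by
      rw [sq, hfsum, Finset.sum_mul_sum]
      simp only [ite_and, ite_mul, one_mul, zero_mul]
    simp_rw [hsq]
    rw [Finset.sum_comm]
    have hrow : ∀ y ∈ S, (∑ x : F × F, ∑ z ∈ S,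
        if x.1 * y.1 + x.2 * y.2 = t ∧ x.1 * z.1 + x.2 * z.2 = t then (1 : ℤ) else 0) ≤
        S.card + q - 1 := by
      intro y hy
      rw [Finset.sum_comm]
      calc _ ≤ ∑ z ∈ S, (1 + if y = z then q - 1 else 0) := by
            refine Finset.sum_le_sum fun z _ => ?_
            rw [Finset.sum_boole]
            split_ifs with h
            · subst h
              simp only [and_self]
              rw [card_line (hS y hy)]
              simp [hq]
            · simpa using card_line_inter_le_one ht h
        _ = _ := by
            rw [Finset.sum_add_distrib, Finset.sum_ite_eq, if_pos hy]
            simp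
            ring
    calc _ ≤ ∑ _y ∈ S, ((S.card : ℤ) + q - 1) := Finset.sum_le_sum hrow
      _ = _ := by rw [Finset.sum_const, nsmul_eq_mul]
  have hplane : ∑ _x : F × F, (S.card : ℤ) ^ 2 = q ^ 2 * S.card ^ 2 := by
    rw [Finset.sum_const, nsmul_eq_mul, Finset.card_univ, Fintype.card_prod, Nat.cast_mul, sq q]
  calc ∑ x, (q * f x - S.card) ^ 2
      = ∑ x, (q ^ 2 * f x ^ 2 - 2 * q * S.card * f x + (S.card : ℤ) ^ 2) :=
        Finset.sum_congr rfl fun x _ => by ring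
    _ = q ^ 2 * ∑ x, f x ^ 2 - 2 * q * S.card * ∑ x, f x + q ^ 2 * S.card ^ 2 := by
        rw [Finset.sum_add_distrib, Finset.sum_sub_distrib, ← Finset.mul_sum, ← Finset.mul_sum,
          hplane]
    _ ≤ q ^ 2 * ((q - 1) * S.card) := by
        rw [first_moment]
        linarith [mul_le_mul_of_nonneg_left second_moment (sq_nonneg q)]

/-- Sums and products: if `q` is a prime power and `A ⊆ F_q` with `|A| > q^{3/4}`,
then every nonzero element of `F_q` lies in `A·A + A·A`. -/
theorem sum_product_covering
    (q : ℕ) (Fq : Type*) [Field Fq] [Fintype Fq]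
    (hcard : Fintype.card Fq = q)
    (A : Finset Fq)
    (hA : (A.card : ℝ) > (q : ℝ) ^ ((3 : ℝ) / 4)) :
    ∀ x : Fq, x ≠ 0 → ∃ a ∈ A, ∃ b ∈ A, ∃ c ∈ A, ∃ e ∈ A, x = a * b + c * e := by
  classical
  intro t ht
  by_contra! hne
  have hA4 : (q : ℤ) ^ 3 < (A.card : ℤ) ^ 4 := by
    have h : (q : ℝ) ^ 3 < (A.card : ℝ) ^ 4 := by
      calc (q : ℝ) ^ 3 = ((q : ℝ) ^ ((3 : ℝ) / 4)) ^ 4 := by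
            rw [← Real.rpow_natCast (_ ^ _), ← Real.rpow_mul (by positivity),
              ← Real.rpow_natCast]
            norm_num
        _ < _ := by gcongr
    exact_mod_cast h
  set E := A ×ˢ A with hE
  have hEcard : (E.card : ℤ) = (A.card : ℤ) ^ 2 := by
    simp [hE, sq]
  have hS : ∀ y ∈ E.erase 0, y ≠ 0 := fun y hy => Finset.ne_of_mem_erase hy
  have hvar := sum_sq_card_line_le ht hS
  rw [hcard] at hvar
  have hzero : ∀ x ∈ E,
      ((E.erase 0).filter fun y => x.1 * y.1 + x.2 * y.2 = t).card = 0 := by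
    intro x hx
    rw [Finset.card_eq_zero, Finset.filter_eq_empty_iff]
    intro y hy hxy
    have hy := Finset.mem_of_mem_erase hy
    rw [hE, Finset.mem_product] at hx hy
    exact hne _ hx.1 _ hy.1 _ hx.2 _ hy.2 hxy.symm
  have hlower : (E.card : ℤ) * ((E.erase 0).card : ℤ) ^ 2 ≤
      (q : ℤ) ^ 2 * ((q - 1) * (E.erase 0).card) := by
    refine le_trans ?_ hvar
    refine le_trans (le_of_eq ?_) (Finset.sum_le_sum_of_subset_of_nonneg (Finset.subset_univ E)
      fun _ _ _ => sq_nonneg _)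
    rw [Finset.sum_congr rfl fun x hx => by rw [hzero x hx]]
    simp
  have hM : (E.card : ℤ) ≤ (E.erase 0).card + 1 := by
    have := Finset.pred_card_le_card_erase (s := E) (a := 0)
    lia
  have hq : (2 : ℤ) ≤ q := by
    rw [← hcard]
    exact_mod_cast Fintype.one_lt_card (α := Fq)
  have hAq : (A.card : ℤ) ≤ q := by
    rw [← hcard]
    exact_mod_cast Finset.card_le_univ A
  have hE2 : (q : ℤ) ^ 3 < (E.card : ℤ) ^ 2 := by
    rw [hEcard]
    linarith [hA4, pow_mul (A.card : ℤ) 2 2]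
  have hEq : (E.card : ℤ) ≤ (q : ℤ) ^ 2 := by
    rw [hEcard]
    gcongr
  have hE1 : (1 : ℤ) < E.card := by
    have : (1 : ℤ) < (E.card : ℤ) ^ 2 := lt_trans (one_lt_pow₀ (by linarith) (by norm_num)) hE2
    nlinarith
  have hMpos : (0 : ℤ) < (E.erase 0).card := by linarith
  have hcancel : (E.card : ℤ) * (E.erase 0).card ≤ (q : ℤ) ^ 2 * (q - 1) := by
    refine le_of_mul_le_mul_right ?_ hMpos
    linarith
  nlinarith
end

section
/- Let q be a prime power, A ⊆ F_q, and C > 0. If |A| ≥ C^{1/2} q^{2/3}, then |A·A + A·A| ≥ q · C^{3/2}/(1 + C^{3/2}). -/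
/-- Cauchy–Schwarz: a map from `s` into `t` has at least `|s|² / |t|` colliding pairs. -/
lemma card_sq_le_card_mul_card_collisions {α β : Type*} [DecidableEq β]
    (s : Finset α) (t : Finset β) (f : α → β) (hf : ∀ x ∈ s, f x ∈ t) :
    s.card ^ 2 ≤ t.card * ((s ×ˢ s).filter fun p => f p.1 = f p.2).card := by
  have hpairs : ((s ×ˢ s).filter fun p => f p.1 = f p.2).card
      = ∑ y ∈ t, (s.filter fun x => f x = y).card ^ 2 := by
    rw [Finset.card_eq_sum_card_fiberwise (f := fun p => f p.1) (t := t)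
      (fun p hp => hf p.1 (by simp at hp; exact hp.1.1))]
    refine Finset.sum_congr rfl fun y _ => ?_
    rw [sq, ← Finset.card_product]
    congr 1
    ext p
    simp only [Finset.mem_filter, Finset.mem_product]
    grind
  rw [hpairs, Finset.card_eq_sum_card_fiberwise hf]
  exact sq_sum_le_card_mul_sum_sq

/-- The linear forms `(b, e) ↦ a * b + r * e` with `a ≠ 0` fixed have, in total over all slopes `r`,
few collisions on a finite set of points. -/
lemma sum_card_collisions_le {F : Type*} [Field F] [Fintype F] [DecidableEq F]
    (E : Finset (F × F)) {a : F} (ha : a ≠ 0) :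
    ∑ r : F, ((E ×ˢ E).filter fun p => a * p.1.1 + r * p.1.2 = a * p.2.1 + r * p.2.2).card
      ≤ E.card ^ 2 + Fintype.card F * E.card := by
  have hswap := Finset.sum_card_bipartiteAbove_eq_sum_card_bipartiteBelow
    (s := (Finset.univ : Finset F)) (t := E ×ˢ E)
    (fun r p => a * p.1.1 + r * p.1.2 = a * p.2.1 + r * p.2.2)
  simp only [Finset.bipartiteAbove, Finset.bipartiteBelow] at hswap
  rw [hswap]
  have hslopes : ∀ p ∈ E ×ˢ E,
      (Finset.univ.filter fun r : F => a * p.1.1 + r * p.1.2 = a * p.2.1 + r * p.2.2).card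
        ≤ 1 + if p.1 = p.2 then Fintype.card F else 0 := by
    rintro ⟨⟨b, e⟩, b', e'⟩ -
    split_ifs with h
    · exact (Finset.card_le_univ _).trans (Nat.le_add_left _ _)
    · rw [add_zero, Finset.card_le_one]
      intro r hr r' hr'
      simp only [Finset.mem_filter, Finset.mem_univ, true_and] at hr hr'
      by_contra hne
      have he : e = e' := by
        have : (r - r') * (e - e') = 0 := by linear_combination hr - hr'
        rcases mul_eq_zero.1 this with h' | h'
        · exact absurd (sub_eq_zero.1 h') hne
        · exact sub_eq_zero.1 h'
      subst he
      exact h (by simpa [ha] using hr)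
  refine (Finset.sum_le_sum hslopes).trans ?_
  rw [Finset.sum_add_distrib, Finset.sum_const, Finset.card_product, ← Finset.sum_filter,
    Finset.sum_const]
  have hdiag : ((E ×ˢ E).filter fun p => p.1 = p.2).card = E.card := by
    rw [← Finset.diag_card E]
    congr 1
    ext p
    simp only [Finset.mem_filter, Finset.mem_product, Finset.mem_diag]
    grind
  rw [hdiag]
  simp only [smul_eq_mul]
  exact le_of_eq (by ring)

/-- If `a ≠ 0` and `S` contains every `a * b + c * e` with `b, c, e ∈ A`, then
`|S| ≥ q |A|³ / (|A|³ + q²)`. -/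
lemma card_cube_mul_le {F : Type*} [Field F] [Fintype F] (A S : Finset F) {a : F} (ha : a ≠ 0)
    (hS : ∀ b ∈ A, ∀ c ∈ A, ∀ e ∈ A, a * b + c * e ∈ S) :
    (A.card : ℝ) ^ 3 * Fintype.card F
      ≤ S.card * ((A.card : ℝ) ^ 3 + (Fintype.card F : ℝ) ^ 2) := by
  classical
  set q : ℝ := (Fintype.card F : ℝ) with hq
  have hq0 : 0 < q := by rw [hq]; exact_mod_cast Fintype.card_pos
  rcases A.eq_empty_or_nonempty with rfl | ⟨c₀, hc₀⟩
  · simp only [Finset.card_empty]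
    norm_num
    positivity
  set n : ℝ := (A.card : ℝ) with hn
  have hn0 : 0 < n := by rw [hn]; exact_mod_cast Finset.card_pos.2 ⟨c₀, hc₀⟩
  set σ : ℝ := (S.card : ℝ) with hσ
  have hσ0 : 0 < σ := by
    rw [hσ]; exact_mod_cast Finset.card_pos.2 ⟨_, hS c₀ hc₀ c₀ hc₀ c₀ hc₀⟩
  set w : F → ℕ := fun r => (((A ×ˢ A) ×ˢ (A ×ˢ A)).filter
    fun p => a * p.1.1 + r * p.1.2 = a * p.2.1 + r * p.2.2).card with hw
  have hmem : ∀ r ∈ A, n ^ 4 / σ ≤ w r := by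
    intro r hr
    have h := card_sq_le_card_mul_card_collisions (A ×ˢ A) S (fun x => a * x.1 + r * x.2)
      (fun x hx => by
        rw [Finset.mem_product] at hx
        exact hS _ hx.1 _ hr _ hx.2)
    rw [Finset.card_product] at h
    have h' : (n * n) ^ 2 ≤ σ * w r := by rw [hn, hσ]; exact_mod_cast h
    rw [div_le_iff₀ hσ0]
    linarith
  have hall : ∀ r, n ^ 4 / q ≤ w r := by
    intro r
    have h := card_sq_le_card_mul_card_collisions (A ×ˢ A) Finset.univ
      (fun x => a * x.1 + r * x.2) (fun x _ => Finset.mem_univ _)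
    rw [Finset.card_product, Finset.card_univ] at h
    have h' : (n * n) ^ 2 ≤ q * w r := by rw [hn, hq]; exact_mod_cast h
    rw [div_le_iff₀ hq0]
    linarith
  have hupper : ∑ r, (w r : ℝ) ≤ n ^ 4 + q * n ^ 2 := by
    have h := sum_card_collisions_le (A ×ˢ A) ha
    rw [Finset.card_product] at h
    have h' : ∑ r, (w r : ℝ) ≤ (n * n) ^ 2 + q * (n * n) := by rw [hn, hq]; exact_mod_cast h
    linarith
  have hlower : n * (n ^ 4 / σ) + (q - n) * (n ^ 4 / q) ≤ ∑ r, (w r : ℝ) := by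
    rw [← Finset.sum_add_sum_compl A]
    refine add_le_add ?_ ?_
    · simpa using Finset.card_nsmul_le_sum A (fun r => (w r : ℝ)) _ hmem
    · have h := Finset.card_nsmul_le_sum Aᶜ (fun r => (w r : ℝ)) _ fun r _ => hall r
      rwa [nsmul_eq_mul, Finset.card_compl, Nat.cast_sub (Finset.card_le_univ A)] at h
  have hkey := hlower.trans hupper
  have hscale : (n * (n ^ 4 / σ) + (q - n) * (n ^ 4 / q)) * (σ * q)
      = n ^ 2 * (n ^ 3 * q + (q - n) * n ^ 2 * σ) := by
    field_simp
  have hmul := mul_le_mul_of_nonneg_right hkey (mul_pos hσ0 hq0).le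
  rw [hscale] at hmul
  refine le_of_mul_le_mul_left ?_ (pow_pos hn0 2)
  linarith

/-- Sums and products: if `q` is a prime power and `A ⊆ F_q` with
`|A| ≥ C^{1/2} q^{2/3}`, then `|A·A + A·A| ≥ q C^{3/2}/(1 + C^{3/2})`. -/
theorem sum_product_card
    (q : ℕ) (Fq : Type*) [Field Fq] [Fintype Fq]
    (hcard : Fintype.card Fq = q)
    (A : Finset Fq) (C : ℝ) (hC : 0 < C)
    (hA : (A.card : ℝ) ≥ C ^ ((1 : ℝ) / 2) * (q : ℝ) ^ ((2 : ℝ) / 3)) :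
    (({x : Fq | ∃ a ∈ A, ∃ b ∈ A, ∃ c ∈ A, ∃ e ∈ A, x = a * b + c * e}).ncard : ℝ)
      ≥ (q : ℝ) * (C ^ ((3 : ℝ) / 2) / (1 + C ^ ((3 : ℝ) / 2))) := by
  classical
  have hq1 : (1 : ℝ) ≤ q := by
    rw [← hcard]; exact_mod_cast Nat.succ_le_of_lt Fintype.card_pos
  have hq0 : (0 : ℝ) < q := by linarith
  have hAcube : C ^ ((3 : ℝ) / 2) * (q : ℝ) ^ 2 ≤ (A.card : ℝ) ^ 3 := by
    have h := pow_le_pow_left₀ (by positivity) hA 3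
    rw [mul_pow, ← Real.rpow_mul_natCast hC.le, ← Real.rpow_mul_natCast hq0.le] at h
    norm_num at h
    exact h
  have hK0 : 0 < C ^ ((3 : ℝ) / 2) := Real.rpow_pos_of_pos hC _
  set K := C ^ ((3 : ℝ) / 2)
  have hAne : A.Nonempty := by
    rw [← Finset.card_pos]
    have : (0 : ℝ) < A.card := lt_of_lt_of_le (by positivity) hA
    exact_mod_cast this
  set T := {x : Fq | ∃ a ∈ A, ∃ b ∈ A, ∃ c ∈ A, ∃ e ∈ A, x = a * b + c * e} with hT
  rw [Set.ncard_eq_toFinset_card']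
  set S := T.toFinset with hS
  have hSmem : ∀ a ∈ A, ∀ b ∈ A, ∀ c ∈ A, ∀ e ∈ A, a * b + c * e ∈ S := by
    intro a ha b hb c hc e he
    rw [hS, Set.mem_toFinset]
    exact ⟨a, ha, b, hb, c, hc, e, he, rfl⟩
  have hSq : (S.card : ℝ) ≤ q := by
    rw [← hcard]; exact_mod_cast Finset.card_le_univ S
  have hmain : (A.card : ℝ) ^ 3 * q ≤ S.card * ((A.card : ℝ) ^ 3 + (q : ℝ) ^ 2) := by
    by_cases h : ∃ a ∈ A, a ≠ 0
    · obtain ⟨a, ha, ha0⟩ := h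
      rw [← hcard]
      exact card_cube_mul_le A S ha0 (hSmem a ha)
    · push Not at h
      obtain ⟨c, hc⟩ := hAne
      have hA1 : A.card = 1 :=
        Finset.card_eq_one.2 ⟨0, Finset.eq_singleton_iff_unique_mem.2 ⟨h c hc ▸ hc, h⟩⟩
      have hS1 : (1 : ℝ) ≤ S.card := by
        exact_mod_cast Nat.succ_le_of_lt (Finset.card_pos.2 ⟨_, hSmem c hc c hc c hc c hc⟩)
      rw [hA1]
      push_cast
      nlinarith
  rw [ge_iff_le, ← mul_div_assoc, div_le_iff₀ (by positivity)]
  have hgap := mul_le_mul_of_nonneg_right hAcube (sub_nonneg.2 hSq)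
  refine le_of_mul_le_mul_right ?_ (pow_pos hq0 2)
  linarith
end

section
/- Let q be a prime power, A ⊆ F_q, and C > 0. Suppose |A| ≥ C q^{2/3}. Then for any nonzero z ∈ A, the set A·A + zA = {ab + zc : a, b, c ∈ A} satisfies |A·A + zA| ≥ q · C^3/(C^3 + 2). -/
/-- The number of lines `x ↦ x * p.1 + z * p.2`, `p ∈ L`, through the point `(a, t)`. -/
noncomputable def lineCount {F : Type*} [Field F] (L : Finset (F × F)) (z a t : F) : ℝ :=
  open Classical in ∑ p ∈ L, if a * p.1 + z * p.2 = t then 1 else 0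

section LineCount

variable {F : Type*} [Field F] [Fintype F]

theorem sum_lineCount (L : Finset (F × F)) (z a : F) :
    ∑ t, lineCount L z a t = L.card := by
  classical
  unfold lineCount
  rw [Finset.sum_comm]
  simp

theorem sum_lineCount_sq (L : Finset (F × F)) (z a : F) :
    ∑ t, lineCount L z a t ^ 2 = open Classical in
      ∑ p ∈ L, ∑ p' ∈ L, if a * p.1 + z * p.2 = a * p'.1 + z * p'.2 then (1 : ℝ) else 0 := by
  classical
  simp only [lineCount, sq, Finset.sum_mul_sum]
  rw [Finset.sum_comm]
  refine Finset.sum_congr rfl fun p _ => ?_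
  rw [Finset.sum_comm]
  refine Finset.sum_congr rfl fun p' _ => ?_
  simp [eq_comm]

/-- Two distinct lines meet at most once. -/
theorem sum_lines_meet_le {z : F} (hz : z ≠ 0) (p p' : F × F) :
    (open Classical in
      ∑ a : F, if a * p.1 + z * p.2 = a * p'.1 + z * p'.2 then (1 : ℝ) else 0) ≤
      1 + open Classical in if p = p' then (Fintype.card F : ℝ) else 0 := by
  classical
  by_cases h : p = p'
  · subst h; simp
  · rw [if_neg h, add_zero, Finset.sum_boole]
    norm_cast
    rw [Finset.card_le_one]
    intro a ha b hb
    simp only [Finset.mem_filter, Finset.mem_univ, true_and] at ha hb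
    by_contra hab
    have h1 : p.1 = p'.1 := by
      have : (a - b) * (p.1 - p'.1) = 0 := by linear_combination ha - hb
      rcases mul_eq_zero.1 this with h0 | h0
      · exact absurd (sub_eq_zero.1 h0) hab
      · exact sub_eq_zero.1 h0
    rw [h1] at ha
    exact h (Prod.ext h1 (mul_left_cancel₀ hz (add_left_cancel ha)))

theorem sum_sum_lineCount_sq_le (L : Finset (F × F)) {z : F} (hz : z ≠ 0) :
    ∑ a, ∑ t, lineCount L z a t ^ 2 ≤ (L.card : ℝ) ^ 2 + Fintype.card F * L.card := by
  classical
  simp only [sum_lineCount_sq]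
  rw [Finset.sum_comm]
  calc _ ≤ ∑ p ∈ L, ∑ p' ∈ L, (1 + if p = p' then (Fintype.card F : ℝ) else 0) := by
        refine Finset.sum_le_sum fun p _ => ?_
        rw [Finset.sum_comm]
        exact Finset.sum_le_sum fun p' _ => by convert sum_lines_meet_le hz p p'
    _ = _ := by
        simp only [Finset.sum_add_distrib, Finset.sum_ite_eq]
        simp
        ring

theorem sum_lineCount_sub_sq (L : Finset (F × F)) (z a : F) :
    ∑ t, (lineCount L z a t - L.card / Fintype.card F) ^ 2 =
      ∑ t, lineCount L z a t ^ 2 - (L.card : ℝ) ^ 2 / Fintype.card F := by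
  have hq : (Fintype.card F : ℝ) ≠ 0 := by exact_mod_cast Fintype.card_ne_zero
  simp only [sub_sq, Finset.sum_add_distrib, Finset.sum_sub_distrib, ← Finset.sum_mul,
    ← Finset.mul_sum, sum_lineCount, Finset.sum_const, Finset.card_univ, nsmul_eq_mul]
  field_simp
  ring

theorem sum_sum_lineCount_sub_sq_le (L : Finset (F × F)) (A : Finset F) {z : F} (hz : z ≠ 0) :
    ∑ a ∈ A, ∑ t, (lineCount L z a t - L.card / Fintype.card F) ^ 2 ≤
      Fintype.card F * L.card := by
  have hq : (Fintype.card F : ℝ) ≠ 0 := by exact_mod_cast Fintype.card_ne_zero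
  calc _ ≤ ∑ a, ∑ t, (lineCount L z a t - L.card / Fintype.card F) ^ 2 :=
        Finset.sum_le_sum_of_subset_of_nonneg (Finset.subset_univ A)
          fun _ _ _ => Finset.sum_nonneg fun _ _ => sq_nonneg _
    _ = ∑ a, ∑ t, lineCount L z a t ^ 2 - (L.card : ℝ) ^ 2 := by
        simp only [sum_lineCount_sub_sq, Finset.sum_sub_distrib, Finset.sum_const,
          Finset.card_univ, nsmul_eq_mul]
        field_simp
    _ ≤ _ := by linarith [sum_sum_lineCount_sq_le L hz]

/-- The second moment of the number of lines of `L` through the points of `A × {t}`. -/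
theorem sum_sq_sum_lineCount_le (L : Finset (F × F)) (A : Finset F) {z : F} (hz : z ≠ 0) :
    ∑ t, (∑ a ∈ A, lineCount L z a t) ^ 2 ≤
      ((A.card : ℝ) * L.card) ^ 2 / Fintype.card F + A.card * (Fintype.card F * L.card) := by
  have hq : (Fintype.card F : ℝ) ≠ 0 := by exact_mod_cast Fintype.card_ne_zero
  set m : ℝ := L.card / Fintype.card F with hm
  have hvar : ∑ t, (∑ a ∈ A, (lineCount L z a t - m)) ^ 2 ≤
      A.card * (Fintype.card F * L.card) := by
    calc _ ≤ ∑ t, (A.card : ℝ) * ∑ a ∈ A, (lineCount L z a t - m) ^ 2 :=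
          Finset.sum_le_sum fun t _ => sq_sum_le_card_mul_sum_sq
      _ = A.card * ∑ a ∈ A, ∑ t, (lineCount L z a t - m) ^ 2 := by
          rw [← Finset.mul_sum, Finset.sum_comm]
      _ ≤ _ := by gcongr; exact sum_sum_lineCount_sub_sq_le L A hz
  have hsum : ∑ t, ∑ a ∈ A, lineCount L z a t = A.card * L.card := by
    rw [Finset.sum_comm]; simp [sum_lineCount]
  have hexp : ∑ t, (∑ a ∈ A, (lineCount L z a t - m)) ^ 2 =
      ∑ t, (∑ a ∈ A, lineCount L z a t) ^ 2 - (A.card * L.card : ℝ) ^ 2 / Fintype.card F := by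
    simp only [Finset.sum_sub_distrib, Finset.sum_const, nsmul_eq_mul, sub_sq,
      Finset.sum_add_distrib, ← Finset.sum_mul, ← Finset.mul_sum, hsum, Finset.card_univ, hm]
    field_simp
    ring
  linarith

/-- If `S` contains every `a * b + z * c` with `a ∈ A` and `(b, c) ∈ L`, then `S` is large. -/
theorem sq_card_mul_card_le (L : Finset (F × F)) (A S : Finset F) {z : F} (hz : z ≠ 0)
    (hS : ∀ a ∈ A, ∀ p ∈ L, a * p.1 + z * p.2 ∈ S) :
    ((A.card : ℝ) * L.card) ^ 2 ≤ S.card *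
      (((A.card : ℝ) * L.card) ^ 2 / Fintype.card F + A.card * (Fintype.card F * L.card)) := by
  classical
  have hsum : ∑ t ∈ S, ∑ a ∈ A, lineCount L z a t = A.card * L.card := by
    rw [Finset.sum_comm, ← nsmul_eq_mul, ← Finset.sum_const]
    refine Finset.sum_congr rfl fun a ha => ?_
    rw [← sum_lineCount L z a]
    refine Finset.sum_subset (Finset.subset_univ S) fun t _ ht => ?_
    exact Finset.sum_eq_zero fun p hp =>
      if_neg fun h : a * p.1 + z * p.2 = t => ht (h ▸ hS a ha p hp)
  rw [← hsum]
  calc _ ≤ (S.card : ℝ) * ∑ t ∈ S, (∑ a ∈ A, lineCount L z a t) ^ 2 :=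
        sq_sum_le_card_mul_sum_sq
    _ ≤ S.card * ∑ t, (∑ a ∈ A, lineCount L z a t) ^ 2 := by
        gcongr
        exact Finset.subset_univ S
    _ ≤ _ := by
        rw [hsum]
        gcongr
        exact sum_sq_sum_lineCount_le L A hz

end LineCount

/-- If `q` is a prime power, `A ⊆ F_q` with `|A| ≥ C q^{2/3}`, then for any nonzero
`z ∈ A` one has `|A·A + zA| ≥ q C³/(C³+2)`. -/
theorem product_plus_dilate_card
    (q : ℕ) (Fq : Type*) [Field Fq] [Fintype Fq]
    (hcard : Fintype.card Fq = q)
    (A : Finset Fq) (C : ℝ) (hC : 0 < C)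
    (hA : (A.card : ℝ) ≥ C * (q : ℝ) ^ ((2 : ℝ) / 3))
    (z : Fq) (hzA : z ∈ A) (hz0 : z ≠ 0) :
    (({x : Fq | ∃ a ∈ A, ∃ b ∈ A, ∃ c ∈ A, x = a * b + z * c}).ncard : ℝ)
      ≥ (q : ℝ) * (C ^ 3 / (C ^ 3 + 2)) := by
  classical
  have hq : (0 : ℝ) < q := by rw [← hcard]; exact_mod_cast Fintype.card_pos
  have hn : (0 : ℝ) < A.card := by exact_mod_cast Finset.card_pos.2 ⟨z, hzA⟩
  set X := {x : Fq | ∃ a ∈ A, ∃ b ∈ A, ∃ c ∈ A, x = a * b + z * c}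
  have key := sq_card_mul_card_le (A ×ˢ A) A X.toFinset hz0 (by
    rintro a ha ⟨b, c⟩ hp
    rw [Finset.mem_product] at hp
    exact Set.mem_toFinset.2 ⟨a, ha, b, hp.1, c, hp.2, rfl⟩)
  rw [← Set.ncard_eq_toFinset_card', Finset.card_product, hcard] at key
  push_cast at key
  have hcube : C ^ 3 * (q : ℝ) ^ 2 ≤ (A.card : ℝ) ^ 3 := by
    calc C ^ 3 * (q : ℝ) ^ 2 = (C * (q : ℝ) ^ ((2 : ℝ) / 3)) ^ 3 := by
          rw [mul_pow, ← Real.rpow_mul_natCast hq.le]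
          norm_num
      _ ≤ _ := by gcongr
  generalize (X.ncard : ℝ) = s at key ⊢
  generalize (A.card : ℝ) = n at *
  generalize (q : ℝ) = r at *
  have hn3 : 0 < n ^ 3 := by positivity
  have key' : n ^ 3 * r ≤ s * (n ^ 3 + r ^ 2) := by
    have h : n ^ 3 * (n ^ 3 * r) ≤ n ^ 3 * (s * (n ^ 3 + r ^ 2)) := by
      calc n ^ 3 * (n ^ 3 * r) = (n * (n * n)) ^ 2 * r := by ring
        _ ≤ s * ((n * (n * n)) ^ 2 / r + n * (r * (n * n))) * r := by gcongr
        _ = _ := by field_simp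
    exact le_of_mul_le_mul_left h hn3
  calc r * (C ^ 3 / (C ^ 3 + 2)) ≤ r * (n ^ 3 / (n ^ 3 + r ^ 2)) := by
        gcongr r * ?_
        rw [div_le_div_iff₀ (by positivity) (by positivity)]
        linarith
    _ = n ^ 3 * r / (n ^ 3 + r ^ 2) := by ring
    _ ≤ s := by rwa [div_le_iff₀ (by positivity)]
end

section
/- Let q be an odd prime power, d ≥ 2, z ∈ F_q, E ⊆ F_q^d, and let F ⊆ F_q^d be any set all of whose elements have d-th coordinate equal to z. Define the distance incidence function ν(t) = |{(x, y) ∈ F × E : ||x − y|| = t}| for t ∈ F_q. Then Σ_{t ∈ F_q} ν(t)^2 ≤ q^{-1} |F|^2 |E|^2 + 3 q^{d-1} |F| |E|. -/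
open Finset

section DistanceIncidence

variable {K ι : Type*} [Field K] [Fintype ι]

/-- If `φ` grows by `s * c` with `c ≠ 0` under translation by `s • v`, and `a` is invariant, then
averaging over these translations replaces `h ∘ φ` by the mean of `h`. -/
theorem card_mul_sum_mul_comp_eq [Fintype K] [DecidableEq ι] (a : (ι → K) → ℝ) (φ : (ι → K) → K) (h : K → ℝ)
    (v : ι → K) {c : K} (hc : c ≠ 0) (ha : ∀ (s : K) w, a (w + s • v) = a w)
    (hφ : ∀ (s : K) w, φ (w + s • v) = φ w + s * c) :
    (Fintype.card K : ℝ) * ∑ w, a w * h (φ w) = (∑ w, a w) * ∑ t, h t := by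
  have translate (s : K) : ∑ w, a w * h (φ w) = ∑ w, a w * h (φ w + s * c) := by
    rw [← Equiv.sum_comp (Equiv.addRight (s • v))]
    simp [ha, hφ]
  have reparam (u : K) : ∑ s, h (u + s * c) = ∑ t, h t :=
    Equiv.sum_comp ((Equiv.mulRight₀ c hc).trans (Equiv.addLeft u)) h
  calc (Fintype.card K : ℝ) * ∑ w, a w * h (φ w)
      = ∑ s : K, ∑ w, a w * h (φ w + s * c) := by
        simp [← translate]
    _ = (∑ w, a w) * ∑ t, h t := by
        rw [sum_comm, sum_mul]
        simp_rw [← mul_sum, reparam]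

/-- The affine form `w ↦ w l + ∑_{i ≠ l} (x i ^ 2 - 2 * x i * w i)`. -/
def liftedDist [DecidableEq ι] (l : ι) (x w : ι → K) : K :=
  w l + ∑ i ∈ univ.erase l, (x i ^ 2 - 2 * x i * w i)

/-- Replace the coordinate `l` of `y` by `(z - y l) ^ 2 + ∑_{i ≠ l} y i ^ 2`. -/
def paraboloidLift [DecidableEq ι] (l : ι) (z : K) (y : ι → K) : ι → K :=
  Function.update y l ((z - y l) ^ 2 + ∑ i ∈ univ.erase l, y i ^ 2)

theorem liftedDist_paraboloidLift [DecidableEq ι] (l : ι) (x y : ι → K) :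
    liftedDist l x (paraboloidLift l (x l) y) = ∑ i, (x i - y i) ^ 2 := by
  have off : ∑ i ∈ univ.erase l, (x i ^ 2 - 2 * x i * paraboloidLift l (x l) y i)
      = ∑ i ∈ univ.erase l, (x i ^ 2 - 2 * x i * y i) :=
    sum_congr rfl fun i hi => by simp [paraboloidLift, ne_of_mem_erase hi]
  rw [liftedDist, off, ← add_sum_erase univ _ (mem_univ l), paraboloidLift,
    Function.update_self, add_assoc, ← sum_add_distrib]
  congr 1
  exact sum_congr rfl fun i _ => by ring

theorem liftedDist_add_smul_single [DecidableEq ι] (l : ι) (x w : ι → K) (s : K) :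
    liftedDist l x (w + s • Pi.single l 1) = liftedDist l x w + s := by
  have off : ∑ i ∈ univ.erase l, (x i ^ 2 - 2 * x i * (w + s • Pi.single l 1 : ι → K) i)
      = ∑ i ∈ univ.erase l, (x i ^ 2 - 2 * x i * w i) :=
    sum_congr rfl fun i hi => by simp [ne_of_mem_erase hi]
  rw [liftedDist, off, liftedDist]
  simp
  ring

theorem liftedDist_add_smul [DecidableEq ι] {l j : ι} (hj : j ≠ l) (x w : ι → K) (s c : K) :
    liftedDist l x (w + s • (Pi.single j 1 + Pi.single l c))
      = liftedDist l x w + s * (c - 2 * x j) := by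
  have off : ∑ i ∈ univ.erase l,
        (x i ^ 2 - 2 * x i * (w + s • (Pi.single j 1 + Pi.single l c) : ι → K) i)
      = ∑ i ∈ univ.erase l, (x i ^ 2 - 2 * x i * w i) - 2 * x j * s := by
    have hjl : j ∈ univ.erase l := by simp [hj]
    rw [← add_sum_erase _ _ hjl, ← add_sum_erase _ (fun i => x i ^ 2 - 2 * x i * w i) hjl]
    have rest : ∑ i ∈ (univ.erase l).erase j,
          (x i ^ 2 - 2 * x i * (w + s • (Pi.single j 1 + Pi.single l c) : ι → K) i)
        = ∑ i ∈ (univ.erase l).erase j, (x i ^ 2 - 2 * x i * w i) :=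
      sum_congr rfl fun i hi => by
        have hij := ne_of_mem_erase hi
        have hil := ne_of_mem_erase (mem_of_mem_erase hi)
        simp [hij, hil]
    rw [rest]
    simp [hj]
    ring
  rw [liftedDist, off, liftedDist]
  simp [hj.symm]
  ring

theorem card_fiber_paraboloidLift_le_two [Fintype K] [DecidableEq ι] [DecidableEq K] (l : ι) (z : K)
    (w : ι → K) : #{y | paraboloidLift l z y = w} ≤ 2 := by
  obtain h | ⟨y₀, hy₀⟩ := (univ.filter fun y => paraboloidLift l z y = w).eq_empty_or_nonempty
  · simp [h]
  have hsub : (univ.filter fun y => paraboloidLift l z y = w)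
      ⊆ {y₀, Function.update y₀ l (2 * z - y₀ l)} := by
    intro y hy
    have heq : paraboloidLift l z y = paraboloidLift l z y₀ := by
      rw [(mem_filter.mp hy).2, (mem_filter.mp hy₀).2]
    have off (i : ι) (hi : i ≠ l) : y i = y₀ i := by
      simpa [paraboloidLift, hi] using congrFun heq i
    have hsum : ∑ i ∈ univ.erase l, y i ^ 2 = ∑ i ∈ univ.erase l, y₀ i ^ 2 :=
      sum_congr rfl fun i hi => by rw [off i (ne_of_mem_erase hi)]
    have hsq : (z - y l) ^ 2 = (z - y₀ l) ^ 2 := by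
      simpa [paraboloidLift, hsum] using congrFun heq l
    rw [mem_insert, mem_singleton]
    refine (sq_eq_sq_iff_eq_or_eq_neg.mp hsq).imp (fun h => ?_) (fun h => ?_)
    · ext i
      obtain rfl | hi := eq_or_ne i l
      · exact sub_right_injective h
      · exact off i hi
    · ext i
      obtain rfl | hi := eq_or_ne i l
      · rw [Function.update_self]
        linear_combination -h
      · rw [Function.update_of_ne hi, off i hi]
  exact (card_le_card hsub).trans card_le_two

theorem sum_comp_paraboloidLift_le [Fintype K] [DecidableEq ι] (l : ι) (z : K) (g : (ι → K) → ℝ)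
    (hg : ∀ w, 0 ≤ g w) : ∑ y, g (paraboloidLift l z y) ≤ 2 * ∑ w, g w := by
  classical
  rw [← sum_fiberwise univ (paraboloidLift l z), mul_sum]
  refine sum_le_sum fun w _ => ?_
  rw [sum_congr rfl fun y hy => by rw [(mem_filter.mp hy).2], sum_const, nsmul_eq_mul]
  gcongr
  · exact hg w
  · exact_mod_cast card_fiber_paraboloidLift_le_two l z w

theorem sum_liftedDist_sq [Fintype K] [DecidableEq ι] (h2 : (2 : K) ≠ 0) (l : ι) (z : K)
    (S : Finset (ι → K)) (hS : ∀ x ∈ S, x l = z) (b : K → ℝ) (hb : ∑ t, b t = 0) :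
    (Fintype.card K : ℝ) * ∑ w, (∑ x ∈ S, b (liftedDist l x w)) ^ 2
      = #S * (Fintype.card K : ℝ) ^ Fintype.card ι * ∑ t, b t ^ 2 := by
  have diag (x : ι → K) : (Fintype.card K : ℝ) *
      ∑ w, b (liftedDist l x w) * b (liftedDist l x w)
        = (Fintype.card K : ℝ) ^ Fintype.card ι * ∑ t, b t ^ 2 := by
    have := card_mul_sum_mul_comp_eq (fun _ => 1) (liftedDist l x) (fun t => b t ^ 2)
      (Pi.single l 1) (one_ne_zero (α := K)) (fun _ _ => rfl)
      (fun s w => by rw [liftedDist_add_smul_single, mul_one])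
    simpa [sq] using this
  have offDiag (x : ι → K) (hx : x ∈ S) (x' : ι → K) (hx' : x' ∈ S) (hne : x' ≠ x) :
      (Fintype.card K : ℝ) * ∑ w, b (liftedDist l x w) * b (liftedDist l x' w) = 0 := by
    obtain ⟨j, hj⟩ := Function.ne_iff.mp hne
    have hjl : j ≠ l := by
      rintro rfl
      exact hj ((hS _ hx').trans (hS _ hx).symm)
    have hc : 2 * x j - 2 * x' j ≠ 0 := by
      rw [← mul_sub]
      exact mul_ne_zero h2 (sub_ne_zero.mpr hj.symm)
    rw [card_mul_sum_mul_comp_eq (fun w => b (liftedDist l x w)) (liftedDist l x') b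
      (Pi.single j 1 + Pi.single l (2 * x j)) hc
      (fun s w => by rw [liftedDist_add_smul hjl, sub_self, mul_zero, add_zero])
      (fun s w => liftedDist_add_smul hjl x' w s _), hb, mul_zero]
  calc (Fintype.card K : ℝ) * ∑ w, (∑ x ∈ S, b (liftedDist l x w)) ^ 2
      = ∑ x ∈ S, ∑ x' ∈ S, (Fintype.card K : ℝ) *
          ∑ w, b (liftedDist l x w) * b (liftedDist l x' w) := by
        simp_rw [sq, sum_mul_sum]
        rw [sum_comm, mul_sum]
        refine sum_congr rfl fun x _ => ?_
        rw [sum_comm, mul_sum]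
    _ = ∑ x ∈ S, (Fintype.card K : ℝ) ^ Fintype.card ι * ∑ t, b t ^ 2 :=
        sum_congr rfl fun x hx => by
          rw [sum_eq_single_of_mem x hx fun x' hx' hne => offDiag x hx x' hx' hne, diag]
    _ = _ := by rw [sum_const, nsmul_eq_mul, mul_assoc]

/-- The variance form of the second moment bound, with constant `2`. -/
theorem sum_sq_distance_deviation_le [Fintype K] (h2 : (2 : K) ≠ 0) (l : ι) (z : K)
    (S E : Finset (ι → K)) (hS : ∀ x ∈ S, x l = z) (b : K → ℝ) (hb : ∑ t, b t = 0)
    (hSE : ∑ t, b t ^ 2 = ∑ y ∈ E, ∑ x ∈ S, b (∑ i, (x i - y i) ^ 2)) :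
    ∑ t, b t ^ 2 ≤ 2 * (Fintype.card K : ℝ) ^ (Fintype.card ι - 1) * #S * #E := by
  classical
  have hq : (0 : ℝ) < Fintype.card K := by exact_mod_cast Fintype.card_pos
  have hι : Fintype.card ι ≠ 0 := (Fintype.card_pos_iff.mpr ⟨l⟩).ne'
  set B := ∑ t, b t ^ 2
  have hB0 : 0 ≤ B := sum_nonneg fun _ _ => sq_nonneg _
  have lifted : ∑ w, (∑ x ∈ S, b (liftedDist l x w)) ^ 2
      = #S * (Fintype.card K : ℝ) ^ (Fintype.card ι - 1) * B := by
    have := sum_liftedDist_sq h2 l z S hS b hb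
    rw [← mul_pow_sub_one hι] at this
    apply mul_left_cancel₀ hq.ne'
    rw [this]
    ring
  have hsq : B ^ 2 ≤ #E * (2 * (#S * (Fintype.card K : ℝ) ^ (Fintype.card ι - 1) * B)) :=
    calc B ^ 2 = (∑ y ∈ E, ∑ x ∈ S, b (∑ i, (x i - y i) ^ 2)) ^ 2 := by rw [hSE]
      _ ≤ #E * ∑ y ∈ E, (∑ x ∈ S, b (∑ i, (x i - y i) ^ 2)) ^ 2 := sq_sum_le_card_mul_sum_sq
      _ ≤ #E * ∑ y : ι → K, (∑ x ∈ S, b (∑ i, (x i - y i) ^ 2)) ^ 2 := by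
        gcongr
        exact subset_univ E
      _ = #E * ∑ y : ι → K, (∑ x ∈ S, b (liftedDist l x (paraboloidLift l z y))) ^ 2 := by
        congr 1
        refine sum_congr rfl fun y _ => ?_
        congr 1
        refine sum_congr rfl fun x hx => ?_
        rw [← hS x hx, liftedDist_paraboloidLift]
      _ ≤ #E * (2 * ∑ w, (∑ x ∈ S, b (liftedDist l x w)) ^ 2) := by
        gcongr
        exact sum_comp_paraboloidLift_le l z (fun w => (∑ x ∈ S, b (liftedDist l x w)) ^ 2) fun _ => sq_nonneg _
      _ = _ := by rw [lifted]
  obtain h | h := hB0.eq_or_lt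
  · rw [← h]
    positivity
  · refine le_of_mul_le_mul_right ?_ h
    linarith

end DistanceIncidence


/-- Second moment bound for the distance incidence function: if `q` is an odd prime
power, `d ≥ 2`, `S ⊆ F_q^d` has all its elements with last coordinate `z`, and
`E ⊆ F_q^d`, then `∑_t ν(t)² ≤ q⁻¹|S|²|E|² + 3 q^{d-1}|S||E|`, where
`ν(t) = |{(x,y) ∈ S × E : ‖x-y‖ = t}|`. -/
theorem distance_incidence_second_moment
    (q : ℕ) (Fq : Type*) [Field Fq] [Fintype Fq]
    (hcard : Fintype.card Fq = q) (hodd : Odd q)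
    (d : ℕ) (hd : 2 ≤ d) (z : Fq)
    (E S : Finset (Fin d → Fq))
    (hS : ∀ x ∈ S, x ⟨d - 1, by omega⟩ = z) :
    ∑ t : Fq,
      (({p : (Fin d → Fq) × (Fin d → Fq) |
          p.1 ∈ S ∧ p.2 ∈ E ∧ ∑ i, (p.1 i - p.2 i) ^ 2 = t}).ncard : ℝ) ^ 2
      ≤ (q : ℝ)⁻¹ * (S.card : ℝ) ^ 2 * (E.card : ℝ) ^ 2
        + 3 * (q : ℝ) ^ (d - 1) * (S.card : ℝ) * (E.card : ℝ) := by
  classical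
  subst hcard
  have h2 : (2 : Fq) ≠ 0 := by
    refine Ring.two_ne_zero fun h => ?_
    exact (Nat.not_even_iff_odd.mpr hodd)
      (Nat.even_iff.mpr (FiniteField.even_card_iff_char_two.mp h))
  have hq : (Fintype.card Fq : ℝ) ≠ 0 := by exact_mod_cast Fintype.card_ne_zero
  set ν : Fq → ℝ := fun t => (({p : (Fin d → Fq) × (Fin d → Fq) |
    p.1 ∈ S ∧ p.2 ∈ E ∧ ∑ i, (p.1 i - p.2 i) ^ 2 = t}).ncard : ℝ) with hν
  change ∑ t, ν t ^ 2 ≤ _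
  have pairing (g : Fq → ℝ) :
      ∑ t, ν t * g t = ∑ y ∈ E, ∑ x ∈ S, g (∑ i, (x i - y i) ^ 2) := by
    have count (t : Fq) : ν t = #{p ∈ S ×ˢ E | ∑ i, (p.1 i - p.2 i) ^ 2 = t} := by
      simp only [hν]
      rw [← Set.ncard_coe_finset]
      congr 2
      ext p
      simp [and_assoc]
    rw [sum_comm, ← sum_product' S E fun x y : Fin d → Fq => g (∑ i, (x i - y i) ^ 2),
      ← sum_fiberwise (S ×ˢ E) fun p => ∑ i, (p.1 i - p.2 i) ^ 2]
    refine sum_congr rfl fun t _ => ?_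
    rw [sum_congr rfl fun p hp => by rw [(mem_filter.mp hp).2], sum_const, nsmul_eq_mul, count]
  have total : ∑ t, ν t = #S * #E := by
    simpa [mul_comm] using pairing fun _ => 1
  set m : ℝ := #S * #E / Fintype.card Fq with hm
  have hmq : Fintype.card Fq * m = #S * #E := by rw [hm]; field_simp
  have mean : ∑ t, (ν t - m) = 0 := by
    simp [sum_sub_distrib, total, hmq]
  have variance : ∑ t, (ν t - m) ^ 2 = ∑ t, ν t * (ν t - m) := by
    rw [← sub_eq_zero, ← sum_sub_distrib]
    calc ∑ t, ((ν t - m) ^ 2 - ν t * (ν t - m)) = ∑ t, -m * (ν t - m) :=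
          sum_congr rfl fun t _ => by ring
      _ = 0 := by rw [← mul_sum, mean, mul_zero]
  have bound := sum_sq_distance_deviation_le h2 ⟨d - 1, by omega⟩ z S E hS (fun t => ν t - m)
    mean (variance.trans (pairing _))
  have expand : ∑ t, ν t ^ 2 = ∑ t, (ν t - m) ^ 2 + m * (#S * #E) := by
    rw [variance, ← total, mul_sum, ← sum_add_distrib]
    exact sum_congr rfl fun t _ => by ring
  have main_term : m * (#S * #E) = (Fintype.card Fq : ℝ)⁻¹ * (#S : ℝ) ^ 2 * (#E : ℝ) ^ 2 := by
    rw [hm]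
    ring
  have slack : 0 ≤ (Fintype.card Fq : ℝ) ^ (d - 1) * #S * #E := by positivity
  rw [Fintype.card_fin] at bound
  rw [expand, main_term]
  linarith
end

section
/- Let q be a prime power, d ≥ 2, let z ∈ F_q be nonzero, E ⊆ F_q^d, and let F ⊆ F_q^d be any set all of whose elements have d-th coordinate equal to z. Define the dot-product incidence function ν(t) = |{(x, y) ∈ F × E : x·y = t}| for t ∈ F_q. Then Σ_{t ∈ F_q} ν(t)^2 ≤ q^{-1} |F|^2 |E|^2 + 2 q^{d-1} |F| |E|. -/
open Finset in
/-- Translating along a direction on which a linear functional does not vanish embeds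
`K × A` into `B` whenever the functional is constant on `A`. -/
theorem card_field_mul_card_le {K V : Type*} [Field K] [Fintype K] [AddCommGroup V] [Module K V]
    (l : V →ₗ[K] K) (v : V) (hv : l v ≠ 0) (c : K) (A B : Finset V)
    (hA : ∀ x ∈ A, l x = c) (hAB : ∀ x ∈ A, ∀ s : K, x + s • v ∈ B) :
    Fintype.card K * #A ≤ #B := by
  rw [← card_univ, ← card_product]
  refine card_le_card_of_injOn (fun p => p.2 + p.1 • v) ?_ ?_
  · rintro ⟨s, x⟩ h
    exact hAB x (by simpa using h) s
  · rintro ⟨s, x⟩ h ⟨s', x'⟩ h' heq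
    have hx : x ∈ A := by simpa using h
    have hx' : x' ∈ A := by simpa using h'
    have heq : x + s • v = x' + s' • v := heq
    have hl := congrArg l heq
    simp only [map_add, map_smul, hA x hx, hA x' hx', smul_eq_mul, add_right_inj] at hl
    obtain rfl := mul_right_cancel₀ hv hl
    simpa using heq

open Finset in
/-- Among the vectors with `k`-th coordinate `z ≠ 0`, at most a proportion `1 / |K|` is
orthogonal to a given nonzero vector. -/
theorem card_field_mul_card_orthogonal_le {K ι : Type*} [Field K] [Fintype K] [DecidableEq K]
    [Fintype ι] [DecidableEq ι] (k : ι) {z : K} (hz : z ≠ 0) {w : ι → K} (hw : w ≠ 0) :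
    Fintype.card K * #{x : ι → K | x k = z ∧ x ⬝ᵥ w = 0} ≤ #{x : ι → K | x k = z} := by
  by_cases h : ∃ j, j ≠ k ∧ w j ≠ 0
  · obtain ⟨j, hjk, hj⟩ := h
    refine card_field_mul_card_le (dotProductBilin K K |>.flip w) (Pi.single j 1) ?_ 0 _ _ ?_ ?_
    · simpa using hj
    · intro x hx
      simpa using (mem_filter.1 hx).2.2
    · intro x hx s
      simpa [Pi.single_apply, hjk.symm] using (mem_filter.1 hx).2.1
  · push Not at h
    have hwk : w = Pi.single k (w k) := by
      ext j
      by_cases hj : j = k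
      · subst hj; simp
      · simp [hj, h j hj]
    have hk : w k ≠ 0 := fun h0 => hw (by rw [hwk, h0, Pi.single_zero])
    rw [filter_eq_empty_iff.2]
    · simp
    · rintro x - ⟨hx, hxw⟩
      rw [hwk, dotProduct_single, hx] at hxw
      exact mul_ne_zero hz hk hxw

open Finset in
theorem card_coordinate_eq_le {K ι : Type*} [Field K] [Fintype K] [DecidableEq K]
    [Fintype ι] [DecidableEq ι] (k : ι) (z : K) :
    #{x : ι → K | x k = z} ≤ Fintype.card K ^ (Fintype.card ι - 1) := by
  have h := card_field_mul_card_le (LinearMap.proj k : (ι → K) →ₗ[K] K) (Pi.single k 1) (by simp) z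
    {x : ι → K | x k = z} univ (by simp) (by simp)
  have hι : 0 < Fintype.card ι := Fintype.card_pos_iff.2 ⟨k⟩
  rw [card_univ, Fintype.card_fun, ← Nat.sub_add_cancel hι, pow_succ, mul_comm] at h
  exact Nat.le_of_mul_le_mul_right h Fintype.card_pos

open Finset in
theorem sum_card_fiber_sq {α β : Type*} [Fintype β] [DecidableEq β] (E : Finset α) (f : α → β) :
    ∑ t, #{y ∈ E | f y = t} ^ 2 = ∑ y ∈ E, ∑ y' ∈ E, if f y = f y' then 1 else 0 := by
  simp_rw [sq, card_filter, sum_mul_sum]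
  rw [sum_comm]
  refine sum_congr rfl fun y _ => ?_
  rw [sum_comm]
  refine sum_congr rfl fun y' _ => ?_
  simp [eq_comm]

open Finset in
theorem sum_sub_div_card_sq {β : Type*} [Fintype β] [Nonempty β] (f : β → ℝ) :
    ∑ t, (f t - (∑ s, f s) / Fintype.card β) ^ 2
      = ∑ t, f t ^ 2 - (∑ s, f s) ^ 2 / Fintype.card β := by
  have hβ : (Fintype.card β : ℝ) ≠ 0 := Nat.cast_ne_zero.2 Fintype.card_ne_zero
  simp_rw [sub_sq, sum_add_distrib, sum_sub_distrib, ← sum_mul, ← mul_sum]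
  simp only [sum_const, card_univ, nsmul_eq_mul]
  field_simp
  ring

open Finset in
/-- The dot products of `x` with `E` are equidistributed on average over the `x` with
`k`-th coordinate `z ≠ 0`. -/
theorem sum_variance_dotProduct_le {K ι : Type*} [Field K] [Fintype K] [DecidableEq K]
    [Fintype ι] [DecidableEq ι] (k : ι) {z : K} (hz : z ≠ 0) (E : Finset (ι → K)) :
    ∑ x : ι → K with x k = z,
        ∑ t, ((#{y ∈ E | x ⬝ᵥ y = t} : ℝ) - #E / Fintype.card K) ^ 2
      ≤ (Fintype.card K : ℝ) ^ (Fintype.card ι - 1) * #E := by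
  set W : Finset (ι → K) := {x : ι → K | x k = z} with hW
  have hq : (0 : ℝ) < Fintype.card K := Nat.cast_pos.2 Fintype.card_pos
  have hvar (x : ι → K) :
      ∑ t, ((#{y ∈ E | x ⬝ᵥ y = t} : ℝ) - #E / Fintype.card K) ^ 2
        = (∑ y ∈ E, ∑ y' ∈ E, if x ⬝ᵥ y = x ⬝ᵥ y' then 1 else 0)
          - (#E : ℝ) ^ 2 / Fintype.card K := by
    have hsum : ∑ t, (#{y ∈ E | x ⬝ᵥ y = t} : ℝ) = #E := by
      exact_mod_cast (card_eq_sum_card_fiberwise (f := fun y => x ⬝ᵥ y) (t := univ)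
        (s := E) (by simp)).symm
    have := sum_sub_div_card_sq fun t => (#{y ∈ E | x ⬝ᵥ y = t} : ℝ)
    rw [hsum] at this
    rw [this]
    congr 1
    exact_mod_cast sum_card_fiber_sq E fun y => x ⬝ᵥ y
  have hpair (y y' : ι → K) :
      (∑ x ∈ W, if x ⬝ᵥ y = x ⬝ᵥ y' then (1 : ℝ) else 0)
        ≤ (if y = y' then (#W : ℝ) else 0) + #W / Fintype.card K := by
    split_ifs with h
    · subst h
      simp only [if_true, sum_const, nsmul_eq_mul, mul_one]
      exact le_add_of_nonneg_right (by positivity)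
    · have := card_field_mul_card_orthogonal_le k hz (sub_ne_zero.2 h)
      rw [← hW] at this
      rw [zero_add, le_div_iff₀ hq, sum_boole, hW, filter_filter, ← hW, mul_comm]
      simp_rw [dotProduct_sub, sub_eq_zero] at this
      exact_mod_cast this
  have hWcard : (#W : ℝ) ≤ (Fintype.card K : ℝ) ^ (Fintype.card ι - 1) := by
    exact_mod_cast card_coordinate_eq_le k z
  simp_rw [hvar, sum_sub_distrib]
  rw [sum_comm]
  simp_rw [sum_comm (s := W)]
  calc _ ≤ (∑ y ∈ E, ∑ y' ∈ E, ((if y = y' then (#W : ℝ) else 0) + #W / Fintype.card K))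
          - ∑ x ∈ W, (#E : ℝ) ^ 2 / Fintype.card K :=
        sub_le_sub_right (sum_le_sum fun y _ => sum_le_sum fun y' _ => hpair y y') _
    _ = #W * #E := by
        have hdiag : ∀ y ∈ E, (∑ y' ∈ E, if y = y' then (#W : ℝ) else 0) = #W :=
          fun y hy => by simp [hy]
        simp_rw [sum_add_distrib]
        rw [sum_congr rfl hdiag]
        simp only [sum_const, nsmul_eq_mul]
        ring
    _ ≤ _ := mul_le_mul_of_nonneg_right hWcard (Nat.cast_nonneg _)

open Finset in
theorem sum_card_dotProduct_eq_sq_le {K ι : Type*} [Field K] [Fintype K] [DecidableEq K]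
    [Fintype ι] [DecidableEq ι] (k : ι) {z : K} (hz : z ≠ 0) (E S : Finset (ι → K))
    (hS : ∀ x ∈ S, x k = z) :
    ∑ t, (∑ x ∈ S, (#{y ∈ E | x ⬝ᵥ y = t} : ℝ)) ^ 2
      ≤ (#S : ℝ) ^ 2 * (#E : ℝ) ^ 2 / Fintype.card K
        + (Fintype.card K : ℝ) ^ (Fintype.card ι - 1) * #S * #E := by
  have htotal : ∑ t, ∑ x ∈ S, (#{y ∈ E | x ⬝ᵥ y = t} : ℝ) = #S * #E := by
    rw [sum_comm, ← nsmul_eq_mul, ← sum_const]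
    refine sum_congr rfl fun x _ => ?_
    exact_mod_cast (card_eq_sum_card_fiberwise (f := fun y => x ⬝ᵥ y) (t := univ)
      (s := E) (by simp)).symm
  have hvar := sum_sub_div_card_sq fun t => ∑ x ∈ S, (#{y ∈ E | x ⬝ᵥ y = t} : ℝ)
  rw [htotal] at hvar
  have hle : ∑ t, (∑ x ∈ S, (#{y ∈ E | x ⬝ᵥ y = t} : ℝ) - #S * #E / Fintype.card K) ^ 2
      ≤ #S * ((Fintype.card K : ℝ) ^ (Fintype.card ι - 1) * #E) := by
    calc _ = ∑ t, (∑ x ∈ S, ((#{y ∈ E | x ⬝ᵥ y = t} : ℝ) - #E / Fintype.card K)) ^ 2 := by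
          simp [sum_sub_distrib, mul_div_assoc]
      _ ≤ ∑ t, #S * ∑ x ∈ S, ((#{y ∈ E | x ⬝ᵥ y = t} : ℝ) - #E / Fintype.card K) ^ 2 :=
          sum_le_sum fun t _ => sq_sum_le_card_mul_sum_sq
      _ = #S * ∑ x ∈ S, ∑ t, ((#{y ∈ E | x ⬝ᵥ y = t} : ℝ) - #E / Fintype.card K) ^ 2 := by
          rw [← mul_sum, sum_comm]
      _ ≤ _ := by
          refine mul_le_mul_of_nonneg_left (le_trans ?_ (sum_variance_dotProduct_le k hz E))
            (Nat.cast_nonneg _)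
          refine sum_le_sum_of_subset_of_nonneg (fun x hx => by simp [hS x hx]) ?_
          exact fun _ _ _ => sum_nonneg fun _ _ => sq_nonneg _
  rw [hvar, mul_pow] at hle
  linarith


/-- Second moment bound for the dot-product incidence function: if `q` is a prime
power, `d ≥ 2`, `z ≠ 0`, `S ⊆ F_q^d` has all its elements with last coordinate `z`,
and `E ⊆ F_q^d`, then `∑_t ν(t)² ≤ q⁻¹|S|²|E|² + 2 q^{d-1}|S||E|`, where
`ν(t) = |{(x,y) ∈ S × E : x·y = t}|`. -/
theorem dot_product_incidence_second_moment
    (q : ℕ) (Fq : Type*) [Field Fq] [Fintype Fq]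
    (hcard : Fintype.card Fq = q)
    (d : ℕ) (hd : 2 ≤ d) (z : Fq) (hz0 : z ≠ 0)
    (E S : Finset (Fin d → Fq))
    (hS : ∀ x ∈ S, x ⟨d - 1, by omega⟩ = z) :
    ∑ t : Fq,
      (({p : (Fin d → Fq) × (Fin d → Fq) |
          p.1 ∈ S ∧ p.2 ∈ E ∧ ∑ i, p.1 i * p.2 i = t}).ncard : ℝ) ^ 2
      ≤ (q : ℝ)⁻¹ * (S.card : ℝ) ^ 2 * (E.card : ℝ) ^ 2
        + 2 * (q : ℝ) ^ (d - 1) * (S.card : ℝ) * (E.card : ℝ) := by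
  classical
  subst hcard
  have hcount (t : Fq) : (({p : (Fin d → Fq) × (Fin d → Fq) |
      p.1 ∈ S ∧ p.2 ∈ E ∧ ∑ i, p.1 i * p.2 i = t}).ncard : ℝ)
        = ∑ x ∈ S, (({y ∈ E | x ⬝ᵥ y = t} : Finset _).card : ℝ) := by
    have hset : {p : (Fin d → Fq) × (Fin d → Fq) |
        p.1 ∈ S ∧ p.2 ∈ E ∧ ∑ i, p.1 i * p.2 i = t}
          = ((S ×ˢ E).filter fun p => p.1 ⬝ᵥ p.2 = t : Finset _) := by
      ext p
      rw [Finset.mem_coe, Finset.mem_filter, Finset.mem_product, and_assoc]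
      rfl
    rw [hset, Set.ncard_coe_finset, Finset.card_filter, Finset.sum_product]
    simp_rw [Finset.card_filter]
    push_cast
    rfl
  simp_rw [hcount]
  have h := sum_card_dotProduct_eq_sq_le _ hz0 E S hS
  rw [Fintype.card_fin, div_eq_inv_mul, ← mul_assoc] at h
  have hnonneg : 0 ≤ (Fintype.card Fq : ℝ) ^ (d - 1) * S.card * E.card := by positivity
  linarith
end

section
/- Let q be an odd prime power, d ≥ 2, z ∈ F_q, E ⊆ F_q^d, and let F ⊆ F_q^d be any set all of whose elements have d-th coordinate equal to z. Then the number of triples (x, y, y') ∈ F × E × E with ||x − y|| = ||x − y'|| is at most q^{-1} |F| |E|^2 + 3 q^{d-1} |E|. -/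
section

open Finset Function

/-- The quadratic distance `‖x - y‖ = ∑ i, (x i - y i) ^ 2`. -/
def quadDist {ι K : Type*} [Fintype ι] [Field K] (x y : ι → K) : K :=
  ∑ i, (x i - y i) ^ 2

variable {ι K : Type*}

theorem quadDist_eq_add_sum_erase [Fintype ι] [DecidableEq ι] [Field K] (l : ι) (x y : ι → K) :
    quadDist x y = (x l - y l) ^ 2 + ∑ i ∈ univ.erase l, (x i - y i) ^ 2 :=
  (add_sum_erase univ _ (mem_univ l)).symm

/-- Cauchy–Schwarz for the number of pairs with the same image. -/
theorem card_sq_le_card_mul_card_filter_eq [Fintype K] [DecidableEq K] {α : Type*}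
    (E : Finset α) (f : α → K) :
    #E ^ 2 ≤ Fintype.card K * #{p ∈ E ×ˢ E | f p.1 = f p.2} := by
  have hE : #E = ∑ t : K, #{y ∈ E | f y = t} :=
    card_eq_sum_card_fiberwise fun _ _ => mem_univ _
  have hpairs : #{p ∈ E ×ˢ E | f p.1 = f p.2} = ∑ t : K, #{y ∈ E | f y = t} ^ 2 := by
    rw [card_eq_sum_card_fiberwise (f := fun p => f p.1) (t := univ) fun _ _ => mem_univ _]
    refine sum_congr rfl fun t _ => ?_
    rw [sq, ← card_product]
    congr 1
    ext p
    simp only [mem_filter, mem_product]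
    grind
  rw [hpairs, hE]
  exact sq_sum_le_card_mul_sum_sq

/-- If the points of `A` are determined by their coordinates other than `i`, and `B` contains every
line in direction `i` through a point of `A`, then `B` is at least `|K|` times as large as `A`. -/
theorem card_mul_card_le_of_update_mem [DecidableEq ι] [Fintype K] (A B : Finset (ι → K)) (i : ι)
    (hAB : ∀ x ∈ A, ∀ t, update x i t ∈ B)
    (hA : ∀ x ∈ A, ∀ x' ∈ A, (∀ j ≠ i, x j = x' j) → x = x') :
    Fintype.card K * #A ≤ #B := by
  rw [mul_comm, ← card_univ, ← card_product]
  refine card_le_card_of_injOn (fun p => update p.1 i p.2) (fun p hp => ?_) ?_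
  · simp only [coe_product, Set.mem_prod, mem_coe] at hp
    exact hAB _ hp.1 _
  · rintro ⟨x, t⟩ hp ⟨x', t'⟩ hp' h
    simp only [coe_product, Set.mem_prod, mem_coe] at hp hp' h
    have ht : t = t' := by simpa using congrFun h i
    have hx : x = x' := hA x hp.1 x' hp'.1 fun j hj => by simpa [hj] using congrFun h j
    rw [ht, hx]

theorem card_mul_card_hyperplane_le [Fintype ι] [DecidableEq ι] [Fintype K] [DecidableEq K]
    (l : ι) (z : K) :
    Fintype.card K * #{x : ι → K | x l = z} ≤ Fintype.card K ^ Fintype.card ι := by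
  rw [← Fintype.card_fun, ← card_univ (α := ι → K)]
  refine card_mul_card_le_of_update_mem _ _ l (fun _ _ _ => mem_univ _) fun x hx x' hx' h => ?_
  simp only [mem_filter, mem_univ, true_and] at hx hx'
  ext j
  by_cases hj : j = l
  · rw [hj, hx, hx']
  · exact h j hj

/-- The perpendicular bisector of two points that differ off the coordinate `l` meets a hyperplane
`x l = z` in at most a `1 / |K|` proportion of its points. -/
theorem card_mul_card_bisector_le [Fintype ι] [DecidableEq ι] [Field K] [Fintype K]
    [DecidableEq K] (h2 : (2 : K) ≠ 0) (l : ι) (z : K) {y y' : ι → K} {i : ι}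
    (hi : i ≠ l) (hy : y i ≠ y' i) :
    Fintype.card K * #{x ∈ ({x : ι → K | x l = z} : Finset (ι → K)) |
      quadDist x y = quadDist x y'} ≤ #{x : ι → K | x l = z} := by
  refine card_mul_card_le_of_update_mem _ _ i (fun x hx t => ?_) fun x hx x' hx' h => ?_
  · simp only [mem_filter, mem_univ, true_and] at hx ⊢
    rw [update_of_ne hi.symm, hx.1]
  · simp only [mem_filter, mem_univ, true_and, quadDist_eq_add_sum_erase i] at hx hx'
    have hsum (w : ι → K) : ∑ j ∈ univ.erase i, (x j - w j) ^ 2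
        = ∑ j ∈ univ.erase i, (x' j - w j) ^ 2 :=
      sum_congr rfl fun j hj => by rw [h j (ne_of_mem_erase hj)]
    rw [hsum, hsum] at hx
    have hxi : 2 * (y i - y' i) * (x i - x' i) = 0 := by
      linear_combination hx'.2 - hx.2
    have hxi : x i = x' i := by
      simpa [h2, sub_eq_zero, hy] using hxi
    ext j
    by_cases hj : j = i
    · rw [hj, hxi]
    · exact h j hj

/-- The number of pairs in `E` agreeing off `l` and equidistant from a hyperplane `x l = z`. -/
theorem card_vertical_pairs_le [Fintype ι] [DecidableEq ι] [Field K] [DecidableEq K]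
    (E : Finset (ι → K)) (l : ι) (z : K) :
    #{p ∈ E ×ˢ E | (∀ j ≠ l, p.1 j = p.2 j) ∧ (z - p.1 l) ^ 2 = (z - p.2 l) ^ 2}
      ≤ 2 * #E := by
  have hsub : ({p ∈ E ×ˢ E | (∀ j ≠ l, p.1 j = p.2 j) ∧ (z - p.1 l) ^ 2 = (z - p.2 l) ^ 2})
      ⊆ E.image (fun y => (y, y)) ∪ E.image (fun y => (y, update y l (2 * z - y l))) := by
    rintro ⟨y, y'⟩ hp
    simp only [mem_filter, mem_product] at hp
    obtain ⟨⟨hy, -⟩, hoff, hsq⟩ := hp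
    rw [mem_union, mem_image, mem_image]
    refine (sq_eq_sq_iff_eq_or_eq_neg.mp hsq).imp (fun h => ⟨y, hy, ?_⟩) fun h => ⟨y, hy, ?_⟩
    · refine Prod.ext rfl (funext fun j => ?_)
      by_cases hj : j = l
      · subst hj; exact sub_right_injective h
      · exact hoff j hj
    · refine Prod.ext rfl (funext fun j => ?_)
      by_cases hj : j = l
      · subst hj
        simp only [update_self]
        linear_combination h
      · simpa [hj] using hoff j hj
  calc _ ≤ _ := card_le_card hsub
    _ ≤ _ := card_union_le _ _
    _ ≤ #E + #E := add_le_add card_image_le card_image_le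
    _ = 2 * #E := (two_mul _).symm

/-- The triple count when the first point ranges over a whole hyperplane `x l = z`. -/
theorem card_mul_sum_hyperplane_le [Fintype ι] [DecidableEq ι] [Field K] [Fintype K]
    [DecidableEq K] (h2 : (2 : K) ≠ 0) (E : Finset (ι → K)) (l : ι) (z : K) :
    Fintype.card K * ∑ x : ι → K with x l = z, #{p ∈ E ×ˢ E | quadDist x p.1 = quadDist x p.2}
      ≤ #{x : ι → K | x l = z} * #E ^ 2
        + 2 * Fintype.card K * #{x : ι → K | x l = z} * #E := by
  set H : Finset (ι → K) := {x : ι → K | x l = z} with hH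
  have hswap := sum_card_bipartiteAbove_eq_sum_card_bipartiteBelow (s := H) (t := E ×ˢ E)
    (fun x p => quadDist x p.1 = quadDist x p.2)
  simp only [bipartiteAbove, bipartiteBelow] at hswap
  rw [hswap, mul_sum]
  calc ∑ p ∈ E ×ˢ E, Fintype.card K * #{x ∈ H | quadDist x p.1 = quadDist x p.2}
      ≤ ∑ p ∈ E ×ˢ E, (#H + if (∀ j ≠ l, p.1 j = p.2 j) ∧ (z - p.1 l) ^ 2 = (z - p.2 l) ^ 2
          then Fintype.card K * #H else 0) := by
        refine sum_le_sum fun p _ => ?_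
        split_ifs with hp
        · exact le_add_left (Nat.mul_le_mul_left _ (card_filter_le _ _))
        by_cases hoff : ∀ j ≠ l, p.1 j = p.2 j
        · have hempty : {x ∈ H | quadDist x p.1 = quadDist x p.2} = ∅ := by
            refine filter_eq_empty_iff.mpr fun x hx hxp => hp ⟨hoff, ?_⟩
            have hxl : x l = z := by simpa [hH] using hx
            have hsum : ∑ j ∈ univ.erase l, (x j - p.1 j) ^ 2
                = ∑ j ∈ univ.erase l, (x j - p.2 j) ^ 2 :=
              sum_congr rfl fun j hj => by rw [hoff j (ne_of_mem_erase hj)]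
            rwa [quadDist_eq_add_sum_erase l, quadDist_eq_add_sum_erase l, hsum, hxl,
              add_left_inj] at hxp
          simp [hempty]
        · push Not at hoff
          obtain ⟨i, hi, hne⟩ := hoff
          exact card_mul_card_bisector_le h2 l z hi hne
    _ = #H * #E ^ 2 + Fintype.card K * #H *
          #{p ∈ E ×ˢ E | (∀ j ≠ l, p.1 j = p.2 j) ∧ (z - p.1 l) ^ 2 = (z - p.2 l) ^ 2} := by
        rw [sum_add_distrib, ← sum_filter, sum_const, sum_const, card_product]
        simp only [smul_eq_mul]
        ring
    _ ≤ #H * #E ^ 2 + Fintype.card K * #H * (2 * #E) := by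
        gcongr
        exact card_vertical_pairs_le E l z
    _ = _ := by ring

/-- The triple count when the first point ranges over a subset of a hyperplane `x l = z`. -/
theorem sum_card_equidistant_pairs_le [Fintype ι] [DecidableEq ι] [Field K] [Fintype K]
    [DecidableEq K] (h2 : (2 : K) ≠ 0) (E S : Finset (ι → K)) (l : ι) (z : K)
    (hS : ∀ x ∈ S, x l = z) :
    ((∑ x ∈ S, #{p ∈ E ×ˢ E | quadDist x p.1 = quadDist x p.2} : ℕ) : ℝ)
      ≤ (Fintype.card K : ℝ)⁻¹ * #S * (#E : ℝ) ^ 2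
        + 2 * (Fintype.card K : ℝ) ^ (Fintype.card ι - 1) * #E := by
  have hq : (0 : ℝ) < Fintype.card K := by exact_mod_cast Fintype.card_pos
  have : Nonempty ι := ⟨l⟩
  have hH := card_mul_card_hyperplane_le l z
  have hsum := card_mul_sum_hyperplane_le h2 E l z
  set H : Finset (ι → K) := {x : ι → K | x l = z}
  have hHcard : (#H : ℝ) ≤ (Fintype.card K : ℝ) ^ (Fintype.card ι - 1) := by
    refine le_of_mul_le_mul_left ?_ hq
    rw [mul_pow_sub_one Fintype.card_ne_zero]
    exact_mod_cast hH
  have hSH : S ⊆ H := fun x hx => mem_filter.mpr ⟨mem_univ _, hS x hx⟩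
  have hmono := sum_le_sum_of_subset_of_nonneg (f := fun x => (Fintype.card K : ℝ) *
    #{p ∈ E ×ˢ E | quadDist x p.1 = quadDist x p.2} - (#E : ℝ) ^ 2) hSH fun x _ _ =>
      sub_nonneg.mpr (by exact_mod_cast card_sq_le_card_mul_card_filter_eq E (quadDist x))
  simp only [sum_sub_distrib, ← mul_sum, sum_const, nsmul_eq_mul] at hmono
  have hsum' : (Fintype.card K : ℝ) *
      ∑ x ∈ H, (#{p ∈ E ×ˢ E | quadDist x p.1 = quadDist x p.2} : ℝ)
      ≤ #H * (#E : ℝ) ^ 2 + 2 * Fintype.card K * #H * #E := by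
    exact_mod_cast hsum
  refine le_of_mul_le_mul_left ?_ hq
  push_cast
  calc _ ≤ #S * (#E : ℝ) ^ 2 + 2 * Fintype.card K * #H * #E := by linarith
    _ ≤ #S * (#E : ℝ) ^ 2
        + 2 * Fintype.card K * (Fintype.card K : ℝ) ^ (Fintype.card ι - 1) * #E := by gcongr
    _ = _ := by field_simp

end

/-- Triple count for equal distances: if `q` is an odd prime power, `d ≥ 2`,
`S ⊆ F_q^d` has all its elements with last coordinate `z`, and `E ⊆ F_q^d`, then
`|{(x,y,y') ∈ S × E × E : ‖x-y‖ = ‖x-y'‖}| ≤ q⁻¹|S||E|² + 3 q^{d-1}|E|`. -/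
theorem equal_distance_triples
    (q : ℕ) (Fq : Type*) [Field Fq] [Fintype Fq]
    (hcard : Fintype.card Fq = q) (hodd : Odd q)
    (d : ℕ) (hd : 2 ≤ d) (z : Fq)
    (E S : Finset (Fin d → Fq))
    (hS : ∀ x ∈ S, x ⟨d - 1, by omega⟩ = z) :
    (({p : (Fin d → Fq) × (Fin d → Fq) × (Fin d → Fq) |
        p.1 ∈ S ∧ p.2.1 ∈ E ∧ p.2.2 ∈ E ∧
          ∑ i, (p.1 i - p.2.1 i) ^ 2 = ∑ i, (p.1 i - p.2.2 i) ^ 2}).ncard : ℝ)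
      ≤ (q : ℝ)⁻¹ * (S.card : ℝ) * (E.card : ℝ) ^ 2
        + 3 * (q : ℝ) ^ (d - 1) * (E.card : ℝ) := by
  classical
  have h2 : (2 : Fq) ≠ 0 := by
    refine Ring.two_ne_zero fun hchar => ?_
    have := FiniteField.even_card_of_char_two hchar
    grind
  have hset : {p : (Fin d → Fq) × (Fin d → Fq) × (Fin d → Fq) |
      p.1 ∈ S ∧ p.2.1 ∈ E ∧ p.2.2 ∈ E ∧
        ∑ i, (p.1 i - p.2.1 i) ^ 2 = ∑ i, (p.1 i - p.2.2 i) ^ 2}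
      = ({p ∈ S ×ˢ E ×ˢ E | quadDist p.1 p.2.1 = quadDist p.1 p.2.2} :
        Finset ((Fin d → Fq) × (Fin d → Fq) × (Fin d → Fq))) := by
    ext p
    rw [Finset.mem_coe, Finset.mem_filter]
    simp only [Set.mem_ofPred_eq, Finset.mem_product, and_assoc, quadDist]
  have hcount : Finset.card {p ∈ S ×ˢ E ×ˢ E | quadDist p.1 p.2.1 = quadDist p.1 p.2.2}
      = ∑ x ∈ S, Finset.card {p ∈ E ×ˢ E | quadDist x p.1 = quadDist x p.2} := by
    simp only [Finset.card_filter, Finset.sum_product S]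
  rw [hset, Set.ncard_coe_finset, hcount]
  refine (sum_card_equidistant_pairs_le h2 E S _ z hS).trans ?_
  rw [hcard, Fintype.card_fin]
  gcongr
  norm_num
end

section
/- Let q be a prime power, d ≥ 2, let z ∈ F_q be nonzero, E ⊆ F_q^d, and let F ⊆ F_q^d be any set all of whose elements have d-th coordinate equal to z. Then the number of triples (x, y, y') ∈ F × E × E with x·y = x·y' is at most q^{-1} |F| |E|^2 + 2 q^{d-1} |E|. -/
open Finset in
/-- The fibres of `f` on `E` give at least `|E|² / |κ|` coincidences. -/
theorem card_sq_le_card_mul_card_coincidences {α κ : Type*} [Fintype κ] [DecidableEq κ]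
    (E : Finset α) (f : α → κ) :
    #E ^ 2 ≤ Fintype.card κ * #{p ∈ E ×ˢ E | f p.1 = f p.2} := by
  have hE : #E = ∑ t, #{y ∈ E | f y = t} :=
    card_eq_sum_card_fiberwise fun _ _ => by simp
  have hN : #{p ∈ E ×ˢ E | f p.1 = f p.2} = ∑ t, #{y ∈ E | f y = t} ^ 2 := by
    rw [card_eq_sum_card_fiberwise (f := fun p => f p.1) (t := univ) fun _ _ => by simp]
    refine sum_congr rfl fun t _ => ?_
    rw [sq, ← card_product]
    congr 1
    ext p
    simp only [mem_filter, mem_product]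
    grind
  rw [hE, hN]
  exact sq_sum_le_card_mul_sum_sq

open Finset in
/-- An affine coordinate hyperplane has at most `q ^ (n - 1)` points. -/
theorem card_coordinate_hyperplane_le {K ι : Type*} [Fintype K] [DecidableEq K]
    [Fintype ι] [DecidableEq ι] (l : ι) (z : K) :
    #{x : ι → K | x l = z} ≤ Fintype.card K ^ (Fintype.card ι - 1) := by
  have h : Fintype.card ({j // j ≠ l} → K) = Fintype.card K ^ (Fintype.card ι - 1) := by
    simp
  rw [← h, ← card_univ]
  refine card_le_card_of_injOn (fun x j => x j) (by simp) fun x hx y hy hxy => ?_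
  simp only [coe_filter, mem_univ, true_and, Set.mem_ofPred_eq] at hx hy
  funext j
  by_cases hj : j = l
  · rw [hj, hx, hy]
  · exact congrFun hxy ⟨j, hj⟩

open Finset in
/-- A nonzero vector `w` is orthogonal to at most a `1 / q` fraction of an affine coordinate
hyperplane that misses the origin. -/
theorem card_mul_card_orthogonal_le {K ι : Type*} [Field K] [Fintype K] [DecidableEq K]
    [Fintype ι] [DecidableEq ι] {l : ι} {z : K} (hz : z ≠ 0) {w : ι → K} (hw : w ≠ 0) :
    Fintype.card K * #{x : ι → K | x l = z ∧ x ⬝ᵥ w = 0} ≤ #{x : ι → K | x l = z} := by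
  by_cases h : ∃ i ≠ l, w i ≠ 0
  · obtain ⟨i, hil, hwi⟩ := h
    rw [← card_univ, ← card_product]
    refine card_le_card_of_injOn (fun p => p.2 + Pi.single i p.1) ?_ ?_
    · intro p hp
      simp_all [hil.symm]
    · rintro ⟨s, x⟩ hx ⟨t, y⟩ hy hxy
      simp only [coe_product, coe_univ, coe_filter, mem_univ, true_and, Set.mem_prod,
        Set.mem_univ, Set.mem_ofPred_eq] at hx hy hxy
      have hst : s = t := by
        have := congrArg (· ⬝ᵥ w) hxy
        simpa [add_dotProduct, hx.2, hy.2, hwi] using this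
      subst hst
      simpa using hxy
  · push Not at h
    have hwl : w l ≠ 0 := fun h0 => hw <| funext fun i => by
      by_cases hi : i = l
      · rw [hi, h0, Pi.zero_apply]
      · exact h i hi
    have hempty : #{x : ι → K | x l = z ∧ x ⬝ᵥ w = 0} = 0 := by
      rw [card_eq_zero, filter_eq_empty_iff]
      rintro x - ⟨hx, hxw⟩
      rw [dotProduct, sum_eq_single l (fun i _ hi => by rw [h i hi, mul_zero]) (by simp), hx] at hxw
      exact mul_ne_zero hz hwl hxw
    simp [hempty]

open Finset in
/-- The total number of coincidences `x ⬝ᵥ y = x ⬝ᵥ y'` over a whole affine coordinate hyperplane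
that misses the origin. -/
theorem card_mul_sum_coincidences_le {K ι : Type*} [Field K] [Fintype K] [DecidableEq K]
    [Fintype ι] [DecidableEq ι] (l : ι) {z : K} (hz : z ≠ 0) (E : Finset (ι → K)) :
    Fintype.card K * ∑ x : ι → K with x l = z, #{p ∈ E ×ˢ E | x ⬝ᵥ p.1 = x ⬝ᵥ p.2} ≤
      #E ^ 2 * #{x : ι → K | x l = z} + Fintype.card K * (#E * #{x : ι → K | x l = z}) := by
  have hswap := sum_card_bipartiteAbove_eq_sum_card_bipartiteBelow (s := {x : ι → K | x l = z})
    (t := E ×ˢ E) (fun (x : ι → K) (p : (ι → K) × (ι → K)) => x ⬝ᵥ p.1 = x ⬝ᵥ p.2)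
  rw [show ∑ x : ι → K with x l = z, #{p ∈ E ×ˢ E | x ⬝ᵥ p.1 = x ⬝ᵥ p.2} = _ from hswap, mul_sum]
  have key : ∀ p ∈ E ×ˢ E, Fintype.card K *
      #(bipartiteBelow (fun (x : ι → K) (p : (ι → K) × (ι → K)) => x ⬝ᵥ p.1 = x ⬝ᵥ p.2)
        {x : ι → K | x l = z} p) ≤
      #{x : ι → K | x l = z} +
        if p.1 = p.2 then Fintype.card K * #{x : ι → K | x l = z} else 0 := by
    intro p _
    split_ifs with hp
    · exact le_add_left (Nat.mul_le_mul_left _ (card_le_card (filter_subset _ _)))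
    · rw [bipartiteBelow, filter_filter, add_zero]
      simpa [dotProduct_sub, sub_eq_zero] using
        card_mul_card_orthogonal_le (l := l) hz (sub_ne_zero.2 hp)
  refine (sum_le_sum key).trans_eq ?_
  rw [sum_add_distrib, sum_const, card_product, sum_product]
  simp only [sum_ite_eq, smul_eq_mul]
  rw [sum_congr rfl fun x hx => if_pos hx, sum_const, smul_eq_mul]
  ring

/-- Triple count for equal dot products: if `q` is a prime power, `d ≥ 2`, `z ≠ 0`,
`S ⊆ F_q^d` has all its elements with last coordinate `z`, and `E ⊆ F_q^d`, then
`|{(x,y,y') ∈ S × E × E : x·y = x·y'}| ≤ q⁻¹|S||E|² + 2 q^{d-1}|E|`. -/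
theorem equal_dot_product_triples
    (q : ℕ) (Fq : Type*) [Field Fq] [Fintype Fq]
    (hcard : Fintype.card Fq = q)
    (d : ℕ) (hd : 2 ≤ d) (z : Fq) (hz0 : z ≠ 0)
    (E S : Finset (Fin d → Fq))
    (hS : ∀ x ∈ S, x ⟨d - 1, by omega⟩ = z) :
    (({p : (Fin d → Fq) × (Fin d → Fq) × (Fin d → Fq) |
        p.1 ∈ S ∧ p.2.1 ∈ E ∧ p.2.2 ∈ E ∧
          ∑ i, p.1 i * p.2.1 i = ∑ i, p.1 i * p.2.2 i}).ncard : ℝ)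
      ≤ (q : ℝ)⁻¹ * (S.card : ℝ) * (E.card : ℝ) ^ 2
        + 2 * (q : ℝ) ^ (d - 1) * (E.card : ℝ) := by
  classical
  subst hcard
  set l : Fin d := ⟨d - 1, by omega⟩
  set N : (Fin d → Fq) → ℕ := fun x => (({p ∈ E ×ˢ E | x ⬝ᵥ p.1 = x ⬝ᵥ p.2}).card) with hN
  set H : Finset (Fin d → Fq) := {x | x l = z} with hH
  have hcount : ({p : (Fin d → Fq) × (Fin d → Fq) × (Fin d → Fq) |
        p.1 ∈ S ∧ p.2.1 ∈ E ∧ p.2.2 ∈ E ∧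
          ∑ i, p.1 i * p.2.1 i = ∑ i, p.1 i * p.2.2 i}).ncard = ∑ x ∈ S, N x := by
    rw [hN, ← Finset.card_sigma,
      ← Finset.card_map (Equiv.sigmaEquivProd _ _).toEmbedding, ← Set.ncard_coe_finset]
    congr 1
    ext p
    obtain ⟨x, y, y'⟩ := p
    simp [dotProduct, and_assoc]
  have hq : (0 : ℝ) < Fintype.card Fq := by exact_mod_cast Fintype.card_pos
  have hSH : S ⊆ H := fun x hx => by simpa [hH] using hS x hx
  have hmono : ∑ x ∈ S, ((Fintype.card Fq : ℝ) * N x - (E.card : ℝ) ^ 2) ≤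
      ∑ x ∈ H, ((Fintype.card Fq : ℝ) * N x - (E.card : ℝ) ^ 2) :=
    Finset.sum_le_sum_of_subset_of_nonneg hSH fun x _ _ => sub_nonneg.2 <| by
      exact_mod_cast card_sq_le_card_mul_card_coincidences E (x ⬝ᵥ ·)
  have htotal : (Fintype.card Fq : ℝ) * ∑ x ∈ H, (N x : ℝ) ≤
      (E.card : ℝ) ^ 2 * H.card + Fintype.card Fq * (E.card * H.card) := by
    exact_mod_cast card_mul_sum_coincidences_le l hz0 E
  have hHcard : (H.card : ℝ) ≤ (Fintype.card Fq : ℝ) ^ (d - 1) := by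
    have := card_coordinate_hyperplane_le l z
    rw [Fintype.card_fin] at this
    exact_mod_cast this
  simp only [Finset.sum_sub_distrib, ← Finset.mul_sum, Finset.sum_const, nsmul_eq_mul] at hmono
  have hEH := mul_le_mul_of_nonneg_left hHcard (Nat.cast_nonneg (α := ℝ) E.card)
  have hpos : 0 ≤ (E.card : ℝ) * (Fintype.card Fq : ℝ) ^ (d - 1) := by positivity
  rw [hcount, Nat.cast_sum]
  refine le_of_mul_le_mul_left ?_ hq
  rw [mul_add, mul_assoc (_⁻¹), mul_inv_cancel_left₀ hq.ne']
  nlinarith [mul_le_mul_of_nonneg_left hEH hq.le, mul_nonneg hq.le hpos]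
end
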